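/- Let t ≥ 1 be an integer and let G be a 2-connected 3t-regular finite simple graph. Let 𝒪 be a set of pairwise edge-disjoint odd cycles of G and let e be an edge of G. Then there exists a t-factor F of G such that e ∈ E(F) and, for every O ∈ 𝒪, the edge set E(F) ∩ E(O) is a non-empty matching of G. -/

import Mathlib

open SimpleGraph

namespace PaperFormalization

variable {V : Type*}

/-- The degree of a vertex in a subgraph. -/
noncomputable def sdeg {G : SimpleGraph V} (H : G.Subgraph) (v : V) : ℕ :=
  (H.neighborSet v).ncard

/-- `H` is a `t`-factor of `G`: a spanning subgraph in which every vertex has degree `t`. -/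
def IsTFactor {G : SimpleGraph V} (H : G.Subgraph) (t : ℕ) : Prop :=
  H.IsSpanning ∧ ∀ v : V, sdeg H v = t

/-- A cycle of `G`: a connected 2-regular subgraph. -/
def IsCycleSG {G : SimpleGraph V} (C : G.Subgraph) : Prop :=
  C.Connected ∧ ∀ v ∈ C.verts, sdeg C v = 2

/-- An odd cycle: a cycle with an odd number of edges. -/
def IsOddCycleSG {G : SimpleGraph V} (C : G.Subgraph) : Prop :=
  IsCycleSG C ∧ Odd C.edgeSet.ncard

/-- A family of subgraphs is pairwise edge-disjoint. -/
def PairwiseEdgeDisjoint {G : SimpleGraph V} (𝒪 : Set G.Subgraph) : Prop :=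
  𝒪.Pairwise fun O₁ O₂ => Disjoint O₁.edgeSet O₂.edgeSet

/-- A family of subgraphs is pairwise vertex-disjoint. -/
def PairwiseVertexDisjoint {G : SimpleGraph V} (𝒪 : Set G.Subgraph) : Prop :=
  𝒪.Pairwise fun O₁ O₂ => Disjoint O₁.verts O₂.verts

/-- `G` is `r`-regular. -/
def IsRegular (G : SimpleGraph V) (r : ℕ) : Prop :=
  ∀ v : V, (G.neighborSet v).ncard = r

/-- `G` is 2-connected: connected, at least 3 vertices, and no cut vertex. -/
def TwoConnected [Fintype V] (G : SimpleGraph V) : Prop :=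
  G.Connected ∧ 3 ≤ Fintype.card V ∧ ∀ v : V, (G.induce {u | u ≠ v}).Connected

/-- `G` is `r`-connected: more than `r` vertices and deleting fewer than `r`
vertices leaves it connected. -/
def KConnected [Fintype V] (r : ℕ) (G : SimpleGraph V) : Prop :=
  r < Fintype.card V ∧ ∀ S : Set V, S.ncard < r → (G.induce Sᶜ).Connected

/-- A set of edges is a matching: pairwise non-adjacent edges. -/
def IsMatchingSet (M : Set (Sym2 V)) : Prop :=
  M.Pairwise fun e f => ∀ v : V, v ∈ e → v ∉ f

section Cubic

variable {V E : Type*} [DecidableEq V] [DecidableEq E]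

/-- `inc` describes a loopless cubic multigraph on the vertex set `W`: `inc v` is the set of
edges at `v`. -/
structure IsCubic (W : Finset V) (inc : V → Finset E) : Prop where
  card_inc : ∀ v ∈ W, (inc v).card = 3
  other : ∀ v ∈ W, ∀ e ∈ inc v, ∃ w ∈ W, w ≠ v ∧ e ∈ inc w ∧ ∀ x ∈ W, e ∈ inc x → x = v ∨ x = w

/-- The edges leaving `X`. -/
def cut (W : Finset V) (inc : V → Finset E) (X : Finset V) : Finset E :=
  X.biUnion inc ∩ (W \ X).biUnion inc

/-- No edge is a bridge. -/
def IsBridgeless (W : Finset V) (inc : V → Finset E) : Prop :=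
  ∀ X ⊆ W, (cut W inc X).card ≠ 1

variable {W : Finset V} {inc : V → Finset E}

theorem mem_cut {X : Finset V} {e : E} :
    e ∈ cut W inc X ↔ (∃ p ∈ X, e ∈ inc p) ∧ ∃ q ∈ W, q ∉ X ∧ e ∈ inc q := by
  simp [cut, and_assoc]

theorem mem_cut_of_ends {X : Finset V} (hX : X ⊆ W) {e : E} {p q : V} (hp : p ∈ W) (hq : q ∈ W)
    (hep : e ∈ inc p) (heq : e ∈ inc q) (h : ∀ x ∈ W, e ∈ inc x → x = p ∨ x = q) :
    e ∈ cut W inc X ↔ ¬ (p ∈ X ↔ q ∈ X) := by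
  rw [mem_cut]
  constructor
  · rintro ⟨⟨r, hr, her⟩, s, hs, hsX, hes⟩
    rcases h r (hX hr) her with rfl | rfl <;> rcases h s hs hes with rfl | rfl <;> tauto
  · intro hh
    by_cases h1 : p ∈ X
    · exact ⟨⟨p, h1, hep⟩, q, hq, by tauto, heq⟩
    · exact ⟨⟨q, by tauto, heq⟩, p, hp, h1, hep⟩

theorem cut_compl {X : Finset V} (hX : X ⊆ W) : cut W inc (W \ X) = cut W inc X := by
  rw [cut, cut, Finset.sdiff_sdiff_eq_self hX, Finset.inter_comm]

theorem IsCubic.sum_card (h : IsCubic W inc) {X : Finset V} (hX : X ⊆ W) (O : Finset E) :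
    ∑ v ∈ X, (O ∩ inc v).card =
      (O ∩ cut W inc X).card + 2 * (O ∩ (X.biUnion inc \ cut W inc X)).card := by
  have h1 : ∑ v ∈ X, (O ∩ inc v).card = ∑ e ∈ O, (X.filter fun v => e ∈ inc v).card := by
    have := Finset.sum_card_bipartiteAbove_eq_sum_card_bipartiteBelow (s := X) (t := O)
      (fun v e => e ∈ inc v)
    simpa [Finset.bipartiteAbove, Finset.bipartiteBelow, Finset.filter_mem_eq_inter] using this
  have h2 : ∀ e ∈ O, (X.filter fun v => e ∈ inc v).card =
      (if e ∈ cut W inc X then 1 else 0) +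
        2 * (if e ∈ X.biUnion inc \ cut W inc X then 1 else 0) := by
    intro e _
    by_cases hE : e ∈ X.biUnion inc
    · obtain ⟨p, hp, hep⟩ := Finset.mem_biUnion.1 hE
      obtain ⟨q, hq, hqp, heq, hu⟩ := h.other p (hX hp) e hep
      have hc := mem_cut_of_ends hX (hX hp) hq hep heq hu
      by_cases hqX : q ∈ X
      · have : X.filter (fun v => e ∈ inc v) = {p, q} := by
          ext x; simp only [Finset.mem_filter, Finset.mem_insert, Finset.mem_singleton]
          constructor
          · rintro ⟨hx, hex⟩; exact hu x (hX hx) hex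
          · rintro (rfl | rfl) <;> tauto
        rw [this, Finset.card_pair hqp.symm]
        simp only [Finset.mem_sdiff]
        simp [hc, hp, hqX, hE] 
      · have : X.filter (fun v => e ∈ inc v) = {p} := by
          ext x; simp only [Finset.mem_filter, Finset.mem_singleton]
          constructor
          · rintro ⟨hx, hex⟩
            rcases hu x (hX hx) hex with rfl | rfl
            · rfl
            · exact absurd hx hqX
          · rintro rfl; tauto
        rw [this]
        simp only [Finset.mem_sdiff]
        simp [hc, hp, hqX]
    · have h3 : e ∉ cut W inc X := fun h' => hE (Finset.mem_inter.1 h').1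
      have : X.filter (fun v => e ∈ inc v) = ∅ := by
        ext x; simp only [Finset.mem_filter, Finset.notMem_empty, iff_false]
        rintro ⟨hx, hex⟩; exact hE (Finset.mem_biUnion.2 ⟨x, hx, hex⟩)
      rw [this]; simp only [Finset.mem_sdiff]; simp [h3, hE]
  rw [h1, Finset.sum_congr rfl h2, Finset.sum_add_distrib, ← Finset.mul_sum]
  simp only [Finset.sum_ite_mem, Finset.sum_const, smul_eq_mul, mul_one]

theorem cut_subset (X : Finset V) : cut W inc X ⊆ X.biUnion inc := Finset.inter_subset_left

theorem IsCubic.three_mul_card (h : IsCubic W inc) {X : Finset V} (hX : X ⊆ W) :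
    3 * X.card = (cut W inc X).card + 2 * (X.biUnion inc \ cut W inc X).card := by
  have := h.sum_card hX (X.biUnion inc)
  rw [Finset.inter_eq_right.2 (cut_subset X), Finset.inter_eq_right.2 Finset.sdiff_subset] at this
  rw [← this, Finset.sum_congr rfl (g := fun _ => 3), Finset.sum_const, smul_eq_mul, mul_comm]
  intro v hv
  rw [Finset.inter_eq_right.2 (Finset.subset_biUnion_of_mem inc hv), h.card_inc v (hX hv)]

theorem IsCubic.even_cut (h : IsCubic W inc) {X : Finset V} (hX : X ⊆ W) {O : Finset E}
    (hO : ∀ v ∈ X, Even (O ∩ inc v).card) : Even (O ∩ cut W inc X).card := by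
  have h1 := h.sum_card hX O
  have h2 : Even (∑ v ∈ X, (O ∩ inc v).card) := Finset.even_sum _ hO
  rw [h1] at h2
  exact (Nat.even_add.1 h2).2 (even_two_mul _)

theorem cut_self : cut W inc W = ∅ := by simp [cut]

theorem cut_empty : cut W inc ∅ = ∅ := by simp [cut]

theorem IsCubic.even_card (h : IsCubic W inc) : Even W.card := by
  have := h.three_mul_card (Finset.Subset.refl W)
  rw [cut_self, Finset.card_empty] at this
  exact Nat.even_iff.2 (by omega)

theorem IsCubic.cut_singleton (h : IsCubic W inc) {z : V} (hz : z ∈ W) :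
    cut W inc {z} = inc z := by
  ext e
  rw [mem_cut]
  constructor
  · rintro ⟨⟨p, hp, he⟩, -⟩; rw [Finset.mem_singleton] at hp; exact hp ▸ he
  · intro he
    obtain ⟨w, hw, hwz, hew, -⟩ := h.other z hz e he
    exact ⟨⟨z, by simp, he⟩, w, hw, by simpa using hwz, hew⟩

theorem IsCubic.card_cut_ne_one_of_small (h : IsCubic W inc) {X : Finset V} (hX : X ⊆ W)
    (hs : X.card ≤ 1) : (cut W inc X).card ≠ 1 := by
  rcases Nat.le_one_iff_eq_zero_or_eq_one.1 hs with h0 | h1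
  · rw [Finset.card_eq_zero.1 h0, cut_empty]; simp
  · obtain ⟨z, rfl⟩ := Finset.card_eq_one.1 h1
    have hz := hX (Finset.mem_singleton_self z)
    rw [h.cut_singleton hz, h.card_inc z hz]; simp

/-- Contracting the complement of `X` to a vertex `z` when three edges leave `X`. -/
theorem IsCubic.contract (h : IsCubic W inc) {X : Finset V} (hX : X ⊆ W)
    (hc : (cut W inc X).card = 3) {z : V} (hzX : z ∉ X) :
    IsCubic (insert z X) (Function.update inc z (cut W inc X)) := by
  have hne : ∀ v ∈ X, v ≠ z := fun v hv hvz => hzX (hvz ▸ hv)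
  refine ⟨?_, ?_⟩
  · intro v hv
    rcases Finset.mem_insert.1 hv with rfl | hv
    · simpa using hc
    · rw [Function.update_of_ne (hne v hv)]; exact h.card_inc v (hX hv)
  · intro v hv e he
    rcases Finset.mem_insert.1 hv with rfl | hv
    · rw [Function.update_self] at he
      obtain ⟨⟨p, hp, hep⟩, q, hq, hqX, heq⟩ := mem_cut.1 he
      refine ⟨p, Finset.mem_insert_of_mem hp, hne p hp, ?_, ?_⟩
      · rwa [Function.update_of_ne (hne p hp)]
      · intro x hx hex
        rcases Finset.mem_insert.1 hx with rfl | hx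
        · exact Or.inl rfl
        · rw [Function.update_of_ne (hne x hx)] at hex
          obtain ⟨w, hw, hwp, hew, hu⟩ := h.other p (hX hp) e hep
          rcases hu x (hX hx) hex with rfl | rfl
          · exact Or.inr rfl
          · rcases hu q hq heq with rfl | rfl <;> contradiction
    · rw [Function.update_of_ne (hne v hv)] at he
      obtain ⟨w, hw, hwv, hew, hu⟩ := h.other v (hX hv) e he
      have hcut := mem_cut_of_ends hX (hX hv) hw he hew hu
      by_cases hwX : w ∈ X
      · refine ⟨w, Finset.mem_insert_of_mem hwX, hwv, ?_, ?_⟩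
        · rwa [Function.update_of_ne (hne w hwX)]
        · intro x hx hex
          rcases Finset.mem_insert.1 hx with rfl | hx
          · rw [Function.update_self] at hex; tauto
          · rw [Function.update_of_ne (hne x hx)] at hex; exact hu x (hX hx) hex
      · refine ⟨z, Finset.mem_insert_self _ _, (hne v hv).symm, ?_, ?_⟩
        · rw [Function.update_self]; tauto
        · intro x hx hex
          rcases Finset.mem_insert.1 hx with rfl | hx
          · exact Or.inr rfl
          · rw [Function.update_of_ne (hne x hx)] at hex
            rcases hu x (hX hx) hex with rfl | rfl
            · exact Or.inl rfl
            · contradiction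

theorem cut_contract {X Y : Finset V} (hX : X ⊆ W) (hY : Y ⊆ X) {z : V} (hzX : z ∉ X) :
    cut (insert z X) (Function.update inc z (cut W inc X)) Y = cut W inc Y := by
  have hne : ∀ v ∈ X, v ≠ z := fun v hv hvz => hzX (hvz ▸ hv)
  ext e
  simp only [mem_cut]
  constructor
  · rintro ⟨⟨p, hp, hep⟩, q, hq, hqY, heq⟩
    rw [Function.update_of_ne (hne p (hY hp))] at hep
    refine ⟨⟨p, hp, hep⟩, ?_⟩
    rcases Finset.mem_insert.1 hq with rfl | hq
    · rw [Function.update_self] at heq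
      obtain ⟨-, q', hq', hqX, hq''⟩ := mem_cut.1 heq
      exact ⟨q', hq', fun h' => hqX (hY h'), hq''⟩
    · rw [Function.update_of_ne (hne q hq)] at heq
      exact ⟨q, hX hq, hqY, heq⟩
  · rintro ⟨⟨p, hp, hep⟩, q, hq, hqY, heq⟩
    refine ⟨⟨p, hp, by rwa [Function.update_of_ne (hne p (hY hp))]⟩, ?_⟩
    by_cases hqX : q ∈ X
    · exact ⟨q, Finset.mem_insert_of_mem hqX, hqY, by rwa [Function.update_of_ne (hne q hqX)]⟩
    · refine ⟨z, Finset.mem_insert_self _ _, fun h' => hzX (hY h'), ?_⟩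
      rw [Function.update_self]
      exact mem_cut.2 ⟨⟨p, hY hp, hep⟩, q, hq, hqX, heq⟩

theorem IsBridgeless.contract (hb : IsBridgeless W inc) {X : Finset V} (hX : X ⊆ W)
    {z : V} (hzX : z ∉ X) :
    IsBridgeless (insert z X) (Function.update inc z (cut W inc X)) := by
  intro Y hY
  by_cases hzY : z ∈ Y
  · rw [← cut_compl hY]
    have : insert z X \ Y ⊆ X := by
      intro x hx
      simp only [Finset.mem_sdiff, Finset.mem_insert] at hx
      rcases hx with ⟨rfl | hx, hxY⟩
      · contradiction
      · exact hx
    rw [cut_contract hX this hzX]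
    exact hb _ (this.trans hX)
  · have : Y ⊆ X := by
      intro x hx
      rcases Finset.mem_insert.1 (hY hx) with rfl | h'
      · contradiction
      · exact h'
    rw [cut_contract hX this hzX]
    exact hb _ (this.trans hX)

end Cubic

section Matching

variable {V E ι : Type*} [DecidableEq V] [DecidableEq E]

/-- `M` is a perfect matching. -/
def IsPerfectMatching (W : Finset V) (inc : V → Finset E) (M : Finset E) : Prop :=
  ∀ v ∈ W, (M ∩ inc v).card = 1

/-- `O` is a family of pairwise disjoint even subgraphs. -/
structure IsEvenFamily (W : Finset V) (inc : V → Finset E) (O : ι → Finset E) : Prop where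
  disj : ∀ i j, i ≠ j → Disjoint (O i) (O j)
  even : ∀ i, ∀ v ∈ W, Even (O i ∩ inc v).card
  subset : ∀ i, O i ⊆ W.biUnion inc

/-- Some perfect matching contains `e` and meets all members of `O` of odd size. -/
def HasHittingMatching (W : Finset V) (inc : V → Finset E) (O : ι → Finset E) (e : E) : Prop :=
  ∃ M, IsPerfectMatching W inc M ∧ e ∈ M ∧ ∀ i, Odd (O i).card → (M ∩ O i).Nonempty

variable {W : Finset V} {inc : V → Finset E} {O : ι → Finset E} {e : E}

theorem IsEvenFamily.contract (hO : IsEvenFamily W inc O) (h : IsCubic W inc) {X : Finset V}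
    (hX : X ⊆ W) {z : V} (hzX : z ∉ X) :
    IsEvenFamily (insert z X) (Function.update inc z (cut W inc X))
      fun i => O i ∩ X.biUnion inc := by
  have hne : ∀ v ∈ X, v ≠ z := fun v hv hvz => hzX (hvz ▸ hv)
  refine ⟨fun i j hij => ?_, fun i v hv => ?_, fun i x hx => ?_⟩
  · exact (hO.disj i j hij).mono Finset.inter_subset_left Finset.inter_subset_left
  · rcases Finset.mem_insert.1 hv with rfl | hv
    · rw [Function.update_self, Finset.inter_assoc, Finset.inter_eq_right.2 (cut_subset X)]
      exact h.even_cut hX fun w hw => hO.even i w (hX hw)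
    · rw [Function.update_of_ne (hne v hv), Finset.inter_assoc,
        Finset.inter_eq_right.2 (Finset.subset_biUnion_of_mem inc hv)]
      exact hO.even i v (hX hv)
  · obtain ⟨v, hv, hxv⟩ := Finset.mem_biUnion.1 (Finset.mem_inter.1 hx).2
    refine Finset.mem_biUnion.2 ⟨v, Finset.mem_insert_of_mem hv, ?_⟩
    rwa [Function.update_of_ne (hne v hv)]

theorem HasHittingMatching.glue (h : IsCubic W inc) (hO : IsEvenFamily W inc O) {X : Finset V}
    (hX : X ⊆ W) {z y : V} (hz : z ∉ X) (hy : y ∉ W \ X)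
    (heX : e ∈ X.biUnion inc)
    (h1 : HasHittingMatching (insert z X) (Function.update inc z (cut W inc X))
      (fun i => O i ∩ X.biUnion inc) e)
    (h2 : ∀ c ∈ cut W inc X, HasHittingMatching (insert y (W \ X))
      (Function.update inc y (cut W inc (W \ X))) (fun i => O i ∩ (W \ X).biUnion inc) c) :
    HasHittingMatching W inc O e := by
  have hnz : ∀ v ∈ X, v ≠ z := fun v hv hvz => hz (hvz ▸ hv)
  have hny : ∀ v ∈ W \ X, v ≠ y := fun v hv hvz => hy (hvz ▸ hv)
  obtain ⟨M, hM, heM, hMO⟩ := h1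
  have hMz := hM z (Finset.mem_insert_self _ _)
  rw [Function.update_self] at hMz
  obtain ⟨c, hc⟩ := Finset.card_eq_one.1 hMz
  have hcc : c ∈ M ∩ cut W inc X := hc ▸ Finset.mem_singleton_self c
  rw [Finset.mem_inter] at hcc
  obtain ⟨N, hN, hcN, hNO⟩ := h2 c hcc.2
  have hNy := hN y (Finset.mem_insert_self _ _)
  rw [Function.update_self, cut_compl hX] at hNy
  obtain ⟨c', hc'⟩ := Finset.card_eq_one.1 hNy
  have hcc' : c = c' := by
    rw [← Finset.mem_singleton, ← hc', Finset.mem_inter]; exact ⟨hcN, hcc.2⟩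
  subst hcc'
  have hM1 : ∀ x ∈ cut W inc X, x ∈ M ↔ x = c := fun x hx => by
    rw [← Finset.mem_singleton, ← hc, Finset.mem_inter]; tauto
  have hN1 : ∀ x ∈ cut W inc X, x ∈ N ↔ x = c := fun x hx => by
    rw [← Finset.mem_singleton, ← hc', Finset.mem_inter]; tauto
  have hmem : ∀ x, x ∈ cut W inc X ↔ x ∈ X.biUnion inc ∧ x ∈ (W \ X).biUnion inc := fun x => by
    rw [cut, Finset.mem_inter]
  refine ⟨(M ∩ X.biUnion inc) ∪ (N ∩ (W \ X).biUnion inc), fun v hv => ?_, ?_, fun i hi => ?_⟩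
  · by_cases hvX : v ∈ X
    · have := hM v (Finset.mem_insert_of_mem hvX)
      rw [Function.update_of_ne (hnz v hvX)] at this
      rw [← this]
      congr 1
      ext x
      have hxv : x ∈ inc v → x ∈ X.biUnion inc := fun h => Finset.mem_biUnion.2 ⟨v, hvX, h⟩
      have := hM1 x
      have := hN1 x
      have := hmem x
      simp only [Finset.mem_inter, Finset.mem_union]
      clear hc' hc hcc hM hN hMO hNO hMz hNy hM1 hN1 hmem hnz hny h2
      grind
    · have hvX : v ∈ W \ X := Finset.mem_sdiff.2 ⟨hv, hvX⟩
      have := hN v (Finset.mem_insert_of_mem hvX)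
      rw [Function.update_of_ne (hny v hvX)] at this
      rw [← this]
      congr 1
      ext x
      have hxv : x ∈ inc v → x ∈ (W \ X).biUnion inc := fun h => Finset.mem_biUnion.2 ⟨v, hvX, h⟩
      have := hM1 x
      have := hN1 x
      have := hmem x
      simp only [Finset.mem_inter, Finset.mem_union]
      clear hc' hc hcc hM hN hMO hNO hMz hNy hM1 hN1 hmem hnz hny h2
      grind
  · simp only [Finset.mem_inter, Finset.mem_union]; exact Or.inl ⟨heM, heX⟩
  · have hev : Even (O i ∩ cut W inc X).card := h.even_cut hX fun w hw => hO.even i w (hX hw)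
    have hu : (O i ∩ X.biUnion inc) ∪ (O i ∩ (W \ X).biUnion inc) = O i := by
      rw [← Finset.inter_union_distrib_left, ← Finset.union_biUnion,
        Finset.union_sdiff_of_subset hX]
      exact Finset.inter_eq_left.2 (hO.subset i)
    have hin : (O i ∩ X.biUnion inc) ∩ (O i ∩ (W \ X).biUnion inc) = O i ∩ cut W inc X := by
      rw [cut, ← Finset.inter_inter_distrib_left]
    have hcard := Finset.card_union_add_card_inter (O i ∩ X.biUnion inc) (O i ∩ (W \ X).biUnion inc)
    rw [hu, hin] at hcard
    have : Odd (O i ∩ X.biUnion inc).card ∨ Odd (O i ∩ (W \ X).biUnion inc).card := by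
      rcases Nat.even_or_odd (O i ∩ X.biUnion inc).card with h' | h'
      · right
        have := hi.add_even hev
        rw [hcard, Nat.odd_add] at this
        by_contra h''
        rw [Nat.not_odd_iff_even] at h''
        exact (Nat.not_odd_iff_even.2 h') (this.2 h'')
      · exact Or.inl h'
    rcases this with h' | h'
    · obtain ⟨x, hx⟩ := hMO i h'
      simp only [Finset.mem_inter] at hx
      exact ⟨x, by simp only [Finset.mem_inter, Finset.mem_union]; tauto⟩
    · obtain ⟨x, hx⟩ := hNO i h'
      simp only [Finset.mem_inter] at hx
      exact ⟨x, by simp only [Finset.mem_inter, Finset.mem_union]; tauto⟩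

end Matching

section Small

variable {V E ι : Type*} [DecidableEq V] [DecidableEq E]
variable {W : Finset V} {inc : V → Finset E} {O : ι → Finset E} {e : E}

theorem IsCubic.exists_ends (h : IsCubic W inc) (he : e ∈ W.biUnion inc) :
    ∃ p ∈ W, ∃ q ∈ W, q ≠ p ∧ e ∈ inc p ∧ e ∈ inc q ∧ ∀ x ∈ W, e ∈ inc x → x = p ∨ x = q := by
  obtain ⟨p, hp, hep⟩ := Finset.mem_biUnion.1 he
  obtain ⟨q, hq, hqp, heq, hu⟩ := h.other p hp e hep
  exact ⟨p, hp, q, hq, hqp, hep, heq, hu⟩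

theorem IsCubic.sum_card_eq (h : IsCubic W inc) (hO : IsEvenFamily W inc O) (i : ι) :
    ∑ v ∈ W, (O i ∩ inc v).card = 2 * (O i).card := by
  rw [h.sum_card Finset.Subset.rfl, cut_self, Finset.sdiff_empty, Finset.inter_empty,
    Finset.card_empty, zero_add, Finset.inter_eq_left.2 (hO.subset i)]

theorem IsCubic.card_inter_inc (h : IsCubic W inc) (hO : IsEvenFamily W inc O) (i : ι) {v : V}
    (hv : v ∈ W) : (O i ∩ inc v).card = 0 ∨ (O i ∩ inc v).card = 2 := by
  have h1 := hO.even i v hv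
  have h2 : (O i ∩ inc v).card ≤ 3 := (Finset.card_le_card Finset.inter_subset_right).trans
    (h.card_inc v hv).le
  interval_cases (O i ∩ inc v).card <;> simp_all +decide

theorem IsCubic.hasHittingMatching_of_card_le_four (h : IsCubic W inc)
    (hO : IsEvenFamily W inc O) (he : e ∈ W.biUnion inc) (hW : W.card ≤ 4) :
    HasHittingMatching W inc O e := by
  obtain ⟨x, hx, a, ha, hax, hex, hea, hu⟩ := h.exists_ends he
  by_cases hp : ∃ p ∈ W, p ≠ x ∧ p ≠ a
  · obtain ⟨p, hp, hpx, hpa⟩ := hp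
    have hsub : ({x, a, p} : Finset V) ⊆ W := by
      intro y; simp only [Finset.mem_insert, Finset.mem_singleton]
      rintro (rfl | rfl | rfl) <;> assumption
    have h3 : ({x, a, p} : Finset V).card = 3 := by
      rw [Finset.card_eq_three]; exact ⟨x, a, p, hax.symm, hpx.symm, hpa.symm, rfl⟩
    have hle := Finset.card_le_card hsub
    have hev := h.even_card
    have h4 : W.card = 4 := by
      rw [Nat.even_iff] at hev; omega
    obtain ⟨q, hq, hqn⟩ := Finset.exists_mem_notMem_of_card_lt_card (s := {x, a, p}) (t := W)
      (by omega)
    simp only [Finset.mem_insert, Finset.mem_singleton, not_or] at hqn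
    obtain ⟨hqx, hqa, hqp⟩ := hqn
    have hWeq : W = {x, a, p, q} := by
      symm
      apply Finset.eq_of_subset_of_card_le
      · intro y; simp only [Finset.mem_insert, Finset.mem_singleton]
        rintro (rfl | rfl | rfl | rfl) <;> assumption
      · rw [h4, Finset.card_insert_of_notMem (by simp; tauto), Finset.card_eq_three.2]
        exact ⟨a, p, q, hpa.symm, fun h => hqa h.symm, fun h => hqp h.symm, rfl⟩
    have hact : (W.biUnion inc).card = 6 := by
      have := h.three_mul_card Finset.Subset.rfl
      rw [cut_self, Finset.sdiff_empty, Finset.card_empty] at this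
      omega
    have hepq : ∀ y ∈ W, y ≠ x → y ≠ a → e ∉ inc y := fun y hy h1 h2 h3 => by
      rcases hu y hy h3 with h | h <;> contradiction
    have hX : ({p, q} : Finset V) ⊆ W := by
      intro y; simp only [Finset.mem_insert, Finset.mem_singleton]
      rintro (rfl | rfl) <;> assumption
    obtain ⟨k, hk⟩ : (({p, q} : Finset V).biUnion inc \ cut W inc {p, q}).Nonempty := by
      rw [Finset.nonempty_iff_ne_empty]
      intro h0
      have h1 := h.three_mul_card hX
      rw [h0, Finset.card_empty, Finset.card_pair (Ne.symm hqp)] at h1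
      have h2 : (cut W inc {p, q}).card < (W.biUnion inc).card := by
        apply Finset.card_lt_card
        rw [Finset.ssubset_iff_of_subset]
        · refine ⟨e, he, fun hc => ?_⟩
          obtain ⟨⟨y, hy, hey⟩, -⟩ := mem_cut.1 hc
          simp only [Finset.mem_insert, Finset.mem_singleton] at hy
          rcases hy with rfl | rfl
          · exact hepq _ hp hpx hpa hey
          · exact hepq _ hq hqx hqa hey
        · exact (cut_subset _).trans (Finset.biUnion_subset_biUnion_of_subset_left _ hX)
      omega
    rw [Finset.mem_sdiff, Finset.mem_biUnion] at hk
    obtain ⟨⟨y, hy, hky⟩, hkc⟩ := hk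
    have hk : ∀ s ∈ W, k ∈ inc s → s = p ∨ s = q := fun s hs hks => by
      by_contra hn
      apply hkc
      rw [mem_cut]
      exact ⟨⟨y, hy, hky⟩, s, hs, by simpa using hn, hks⟩
    have hkpq : k ∈ inc p ∧ k ∈ inc q := by
      obtain ⟨s, hs, hsy, hks, -⟩ := h.other y (hX hy) k hky
      have := hk s hs hks
      have := hk y (hX hy) hky
      grind
    have hmem : ∀ s ∈ W, (s = x ∨ s = a) ∧ e ∈ inc s ∧ k ∉ inc s ∨
        (s = p ∨ s = q) ∧ e ∉ inc s ∧ k ∈ inc s := by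
      intro s hs
      have := hk s hs
      have := hepq s hs
      rw [hWeq] at hs
      simp only [Finset.mem_insert, Finset.mem_singleton] at hs
      grind
    refine ⟨{e, k}, fun s hs => ?_, by simp, fun i hi => ?_⟩
    · rw [Finset.card_eq_one]
      rcases hmem s hs with ⟨-, h1, h2⟩ | ⟨-, h1, h2⟩
      · exact ⟨e, by
          ext
          simp only [Finset.mem_inter, Finset.mem_insert, Finset.mem_singleton]
          grind⟩
      · exact ⟨k, by
          ext
          simp only [Finset.mem_inter, Finset.mem_insert, Finset.mem_singleton]
          grind⟩
    · by_contra hn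
      have heO : e ∉ O i := fun h' => hn ⟨e, by simp [h']⟩
      have hkO : k ∉ O i := fun h' => hn ⟨k, by simp [h']⟩
      have hsum := h.sum_card_eq hO i
      have hz : ∃ z ∈ W, (O i ∩ inc z).card = 0 := by
        by_contra hz
        push Not at hz
        rw [Finset.sum_congr rfl (g := fun _ => 2) fun v hv =>
          (h.card_inter_inc hO i hv).resolve_left (hz v hv), Finset.sum_const, h4] at hsum
        rw [Nat.odd_iff] at hi
        simp only [smul_eq_mul] at hsum
        omega
      obtain ⟨z, hz, hOz⟩ := hz
      have hdisj : Disjoint (O i) (inc z) := by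
        rw [Finset.disjoint_iff_inter_eq_empty]; exact Finset.card_eq_zero.1 hOz
      have hlt : (O i).card < 3 := by
        have h1 : (O i ∪ inc z).card < (W.biUnion inc).card := by
          apply Finset.card_lt_card
          rw [Finset.ssubset_iff_of_subset]
          · rcases hmem z hz with ⟨-, h1, h2⟩ | ⟨-, h1, h2⟩
            · exact ⟨k, Finset.mem_biUnion.2 ⟨p, hp, hkpq.1⟩, by simp [hkO, h2]⟩
            · exact ⟨e, he, by simp [heO, h1]⟩
          · exact Finset.union_subset (hO.subset i) (Finset.subset_biUnion_of_mem inc hz)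
        rw [Finset.card_union_of_disjoint hdisj, h.card_inc z hz] at h1
        omega
      have hO1 : (O i).card = 1 := by rw [Nat.odd_iff] at hi; omega
      obtain ⟨f, hf⟩ := Finset.card_eq_one.1 hO1
      obtain ⟨s, hs, hfs⟩ := Finset.mem_biUnion.1 (hO.subset i (hf ▸ Finset.mem_singleton_self f))
      have := hO.even i s hs
      rw [hf, Finset.singleton_inter_of_mem hfs] at this
      simp at this
  · push Not at hp
    have hend : ∀ y ∈ W, y = x ∨ y = a := fun y hy => by
      by_cases h' : y = x
      · exact Or.inl h'
      · exact Or.inr (hp y hy h')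
    refine ⟨{e}, fun s hs => ?_, by simp, fun i hi => ?_⟩
    · rcases hend s hs with rfl | rfl
      · rw [Finset.singleton_inter_of_mem hex]; simp
      · rw [Finset.singleton_inter_of_mem hea]; simp
    · exfalso
      have : O i ⊆ inc x := fun f hf => by
        obtain ⟨s, hs, r, hr, hrs, hfs, hfr, -⟩ := h.exists_ends (hO.subset i hf)
        rcases hend s hs with rfl | rfl
        · exact hfs
        · rcases hend r hr with rfl | rfl
          · exact hfr
          · contradiction
      have h' := hO.even i x hx
      rw [Finset.inter_eq_left.2 this] at h'
      exact (Nat.not_odd_iff_even.2 h') hi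

end Small

section Reduction

variable {V E ι : Type*} [DecidableEq V] [DecidableEq E]

/-- The edge `γ = uv`, with `α = ua`, `β = ub` the other edges at `u` and `κ = vc`, `δ = vd` the
other edges at `v`. Deleting `u` and `v` and joining `a` to `c` and `b` to `d` is Frink's
reduction. -/
structure IsReducible (W : Finset V) (inc : V → Finset E) (u v a b c d : V) (α β γ κ δ : E) :
    Prop where
  hu : u ∈ W
  hv : v ∈ W
  ha : a ∈ W
  hb : b ∈ W
  hc : c ∈ W
  hd : d ∈ W
  huv : u ≠ v
  hau : a ≠ u
  hav : a ≠ v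
  hbu : b ≠ u
  hbv : b ≠ v
  hcu : c ≠ u
  hcv : c ≠ v
  hdu : d ≠ u
  hdv : d ≠ v
  hac : a ≠ c
  hbd : b ≠ d
  inc_u : inc u = {α, β, γ}
  inc_v : inc v = {γ, κ, δ}
  mem_a : α ∈ inc a
  mem_b : β ∈ inc b
  mem_c : κ ∈ inc c
  mem_d : δ ∈ inc d

/-- After the reduction `α` joins `a` to `c` and `β` joins `b` to `d`. -/
def reduceMap (α β κ δ x : E) : E := if x = κ then α else if x = δ then β else x

/-- The incidence function after the reduction. -/
def reduceInc (inc : V → Finset E) (α β κ δ : E) (w : V) : Finset E :=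
  (inc w).image (reduceMap α β κ δ)

/-- The vertex set after the reduction. -/
def reduceVerts (W : Finset V) (u v : V) : Finset V := (W.erase u).erase v

variable {W : Finset V} {inc : V → Finset E} {O : ι → Finset E} {e : E}
variable {u v a b c d : V} {α β γ κ δ : E}

theorem mem_reduceVerts {w : V} : w ∈ reduceVerts W u v ↔ w ≠ u ∧ w ≠ v ∧ w ∈ W := by
  simp only [reduceVerts, Finset.mem_erase]; tauto

theorem IsCubic.eq_or_eq (h : IsCubic W inc) {p q : V} {x : E} (hp : p ∈ W) (hq : q ∈ W)
    (hpq : p ≠ q) (hxp : x ∈ inc p) (hxq : x ∈ inc q) :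
    ∀ w ∈ W, (x ∈ inc w ↔ w = p ∨ w = q) := by
  obtain ⟨r, hr, -, -, hu⟩ := h.other p hp x hxp
  intro w hw
  constructor
  · intro hxw
    have h1 := hu q hq hxq
    have h2 := hu w hw hxw
    grind
  · rintro (rfl | rfl) <;> assumption

theorem ne_of_card_eq_three {x y z : E} (h : ({x, y, z} : Finset E).card = 3) :
    x ≠ y ∧ x ≠ z ∧ y ≠ z := by
  refine ⟨?_, ?_, ?_⟩ <;> rintro rfl
  · rw [Finset.insert_eq_of_mem (by simp)] at h
    have := Finset.card_le_two (a := x) (b := z); omega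
  · rw [Finset.insert_eq_of_mem (by simp)] at h
    have := Finset.card_le_two (a := y) (b := x); omega
  · rw [Finset.pair_eq_singleton] at h
    have := Finset.card_le_two (a := x) (b := y); omega

namespace IsReducible

theorem distinct (H : IsReducible W inc u v a b c d α β γ κ δ) (h : IsCubic W inc) :
    α ≠ β ∧ α ≠ γ ∧ β ≠ γ ∧ κ ≠ δ ∧ κ ≠ γ ∧ δ ≠ γ ∧ α ≠ κ ∧ α ≠ δ ∧ β ≠ κ ∧ β ≠ δ := by
  have h1 := h.card_inc u H.hu
  have h2 := h.card_inc v H.hv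
  rw [H.inc_u] at h1
  rw [H.inc_v] at h2
  have h3 := ne_of_card_eq_three h1
  have h4 := ne_of_card_eq_three h2
  have hα : α ∉ inc v := by
    rw [h.eq_or_eq H.hu H.ha H.hau.symm (by simp [H.inc_u]) H.mem_a v H.hv]
    have := H.huv; have := H.hav; grind
  have hβ : β ∉ inc v := by
    rw [h.eq_or_eq H.hu H.hb H.hbu.symm (by simp [H.inc_u]) H.mem_b v H.hv]
    have := H.huv; have := H.hbv; grind
  rw [H.inc_v] at hα hβ
  simp only [Finset.mem_insert, Finset.mem_singleton, not_or] at hα hβ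
  exact ⟨h3.1, h3.2.1, h3.2.2, h4.2.2, h4.1.symm, h4.2.1.symm, hα.2.1, hα.2.2, hβ.2.1, hβ.2.2⟩

theorem mem_reduceInc (H : IsReducible W inc u v a b c d α β γ κ δ) (h : IsCubic W inc) {w : V}
    (hw : w ∈ reduceVerts W u v) :
    (α ∈ reduceInc inc α β κ δ w ↔ w = a ∨ w = c) ∧
    (β ∈ reduceInc inc α β κ δ w ↔ w = b ∨ w = d) ∧
    γ ∉ reduceInc inc α β κ δ w ∧ κ ∉ reduceInc inc α β κ δ w ∧ δ ∉ reduceInc inc α β κ δ w ∧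
    ∀ x, x ≠ α → x ≠ β → (x ∈ reduceInc inc α β κ δ w ↔ x ∈ inc w ∧ x ≠ γ ∧ x ≠ κ ∧ x ≠ δ) := by
  obtain ⟨h1, h2, h3, h4, h5, h6, h7, h8, h9, h10⟩ := H.distinct h
  rw [mem_reduceVerts] at hw
  obtain ⟨hwu, hwv, hw⟩ := hw
  have hα := h.eq_or_eq H.hu H.ha H.hau.symm (x := α) (by simp [H.inc_u]) H.mem_a w hw
  have hβ := h.eq_or_eq H.hu H.hb H.hbu.symm (x := β) (by simp [H.inc_u]) H.mem_b w hw
  have hγ := h.eq_or_eq H.hu H.hv H.huv (x := γ) (by simp [H.inc_u]) (by simp [H.inc_v]) w hw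
  have hκ := h.eq_or_eq H.hv H.hc H.hcv.symm (x := κ) (by simp [H.inc_v]) H.mem_c w hw
  have hδ := h.eq_or_eq H.hv H.hd H.hdv.symm (x := δ) (by simp [H.inc_v]) H.mem_d w hw
  have key : ∀ x, x ∈ reduceInc inc α β κ δ w ↔ (x ∈ inc w ∧ x ≠ κ ∧ x ≠ δ) ∨
      (x = α ∧ κ ∈ inc w) ∨ (x = β ∧ δ ∈ inc w) := by
    intro x
    simp only [reduceInc, reduceMap, Finset.mem_image]
    constructor
    · rintro ⟨y, hy, rfl⟩
      split_ifs with hk hd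
      · subst hk; simp [hy]
      · subst hd; simp [hy]
      · exact Or.inl ⟨hy, hk, hd⟩
    · rintro (⟨hx, hk, hd⟩ | ⟨rfl, hk⟩ | ⟨rfl, hd⟩)
      · exact ⟨x, hx, by simp [hk, hd]⟩
      · exact ⟨κ, hk, by simp⟩
      · exact ⟨δ, hd, by simp [h4.symm]⟩
  simp only [key]
  refine ⟨?_, ?_, ?_, ?_, ?_, ?_⟩
  · grind
  · grind
  · grind
  · grind
  · grind
  · intro x hxa hxb
    grind

theorem injOn (H : IsReducible W inc u v a b c d α β γ κ δ) (h : IsCubic W inc) {w : V}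
    (hw : w ∈ reduceVerts W u v) : Set.InjOn (reduceMap α β κ δ) (inc w) := by
  obtain ⟨h1, h2, h3, h4, h5, h6, h7, h8, h9, h10⟩ := H.distinct h
  rw [mem_reduceVerts] at hw
  obtain ⟨hwu, hwv, hw⟩ := hw
  have hα := h.eq_or_eq H.hu H.ha H.hau.symm (x := α) (by simp [H.inc_u]) H.mem_a w hw
  have hβ := h.eq_or_eq H.hu H.hb H.hbu.symm (x := β) (by simp [H.inc_u]) H.mem_b w hw
  have hκ := h.eq_or_eq H.hv H.hc H.hcv.symm (x := κ) (by simp [H.inc_v]) H.mem_c w hw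
  have hδ := h.eq_or_eq H.hv H.hd H.hdv.symm (x := δ) (by simp [H.inc_v]) H.mem_d w hw
  have := H.hac
  have := H.hbd
  intro x hx y hy hxy
  simp only [reduceMap, Finset.mem_coe] at hx hy hxy
  split_ifs at hxy <;> grind

theorem isCubic (H : IsReducible W inc u v a b c d α β γ κ δ) (h : IsCubic W inc) :
    IsCubic (reduceVerts W u v) (reduceInc inc α β κ δ) := by
  refine ⟨fun w hw => ?_, fun w hw x hx => ?_⟩
  · rw [reduceInc, Finset.card_image_of_injOn (H.injOn h hw)]
    exact h.card_inc w (mem_reduceVerts.1 hw).2.2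
  · have hmem := fun y hy => H.mem_reduceInc h (w := y) hy
    have ha' : a ∈ reduceVerts W u v := mem_reduceVerts.2 ⟨H.hau, H.hav, H.ha⟩
    have hb' : b ∈ reduceVerts W u v := mem_reduceVerts.2 ⟨H.hbu, H.hbv, H.hb⟩
    have hc' : c ∈ reduceVerts W u v := mem_reduceVerts.2 ⟨H.hcu, H.hcv, H.hc⟩
    have hd' : d ∈ reduceVerts W u v := mem_reduceVerts.2 ⟨H.hdu, H.hdv, H.hd⟩
    by_cases hxα : x = α
    · subst hxα
      rw [(hmem w hw).1] at hx
      have hac := H.hac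
      rcases hx with rfl | rfl
      · refine ⟨c, hc', hac.symm, ?_, fun y hy hxy => ?_⟩
        · rw [(hmem c hc').1]; exact Or.inr rfl
        · rwa [(hmem y hy).1] at hxy
      · refine ⟨a, ha', hac, ?_, fun y hy hxy => ?_⟩
        · rw [(hmem a ha').1]; exact Or.inl rfl
        · rw [(hmem y hy).1] at hxy; exact hxy.symm
    · by_cases hxβ : x = β
      · subst hxβ
        rw [(hmem w hw).2.1] at hx
        have hbd := H.hbd
        rcases hx with rfl | rfl
        · refine ⟨d, hd', hbd.symm, ?_, fun y hy hxy => ?_⟩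
          · rw [(hmem d hd').2.1]; exact Or.inr rfl
          · rwa [(hmem y hy).2.1] at hxy
        · refine ⟨b, hb', hbd, ?_, fun y hy hxy => ?_⟩
          · rw [(hmem b hb').2.1]; exact Or.inl rfl
          · rw [(hmem y hy).2.1] at hxy; exact hxy.symm
      · have hm := fun y hy => (hmem y hy).2.2.2.2.2 x hxα hxβ
        rw [hm w hw] at hx
        obtain ⟨hx, hxγ, hxκ, hxδ⟩ := hx
        obtain ⟨y, hy, hyw, hxy, hu⟩ := h.other w (mem_reduceVerts.1 hw).2.2 x hx
        have hyu : y ≠ u := by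
          rintro rfl; rw [H.inc_u] at hxy
          simp only [Finset.mem_insert, Finset.mem_singleton] at hxy; tauto
        have hyv : y ≠ v := by
          rintro rfl; rw [H.inc_v] at hxy
          simp only [Finset.mem_insert, Finset.mem_singleton] at hxy; tauto
        have hy' : y ∈ reduceVerts W u v := mem_reduceVerts.2 ⟨hyu, hyv, hy⟩
        refine ⟨y, hy', hyw, (hm y hy').2 ⟨hxy, hxγ, hxκ, hxδ⟩, fun z hz hxz => ?_⟩
        exact hu z (mem_reduceVerts.1 hz).2.2 ((hm z hz).1 hxz).1

/-- A perfect matching of the reduced graph avoiding `α` lifts. -/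
theorem lift (H : IsReducible W inc u v a b c d α β γ κ δ) (h : IsCubic W inc) {N : Finset E}
    (hN : IsPerfectMatching (reduceVerts W u v) (reduceInc inc α β κ δ) N)
    (heN : e ∈ N) (hea : e ∈ reduceInc inc α β κ δ a) (heα : e ≠ α) :
    ∃ M, IsPerfectMatching W inc M ∧ (∀ x ∈ N, x ≠ γ → x ≠ κ → x ≠ δ → x ∈ M) ∧
      (γ ∈ M ∨ δ ∈ M) := by
  obtain ⟨h1, h2, h3, h4, h5, h6, h7, h8, h9, h10⟩ := H.distinct h
  have ha' : a ∈ reduceVerts W u v := mem_reduceVerts.2 ⟨H.hau, H.hav, H.ha⟩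
  have hα : α ∉ N := by
    intro hα
    have h1 := hN a ha'
    obtain ⟨f, hf⟩ := Finset.card_eq_one.1 h1
    have e1 : e ∈ N ∩ reduceInc inc α β κ δ a := Finset.mem_inter.2 ⟨heN, hea⟩
    have e2 : α ∈ N ∩ reduceInc inc α β κ δ a :=
      Finset.mem_inter.2 ⟨hα, (H.mem_reduceInc h ha').1.2 (Or.inl rfl)⟩
    rw [hf, Finset.mem_singleton] at e1 e2
    exact heα (e1.trans e2.symm)
  have hM : ∃ M : Finset E, (γ ∈ M ↔ β ∉ N) ∧ (δ ∈ M ↔ β ∈ N) ∧ κ ∉ M ∧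
      ∀ x, x ≠ γ → x ≠ κ → x ≠ δ → (x ∈ M ↔ x ∈ N) := by
    by_cases hβ : β ∈ N
    · refine ⟨insert δ (N \ {γ, κ, δ}), ?_, ?_, ?_, fun x => ?_⟩ <;> simp <;> grind
    · refine ⟨insert γ (N \ {γ, κ, δ}), ?_, ?_, ?_, fun x => ?_⟩ <;> simp <;> grind
  obtain ⟨M, hγ, hδ, hκ, hM⟩ := hM
  refine ⟨M, fun w hw => ?_, fun x hx g1 g2 g3 => (hM x g1 g2 g3).2 hx, by tauto⟩
  have hMα := hM α h2 h7 h8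
  have hMβ := hM β h3 h9 h10
  by_cases hwu : w = u
  · subst hwu
    rw [H.inc_u, Finset.card_eq_one]
    by_cases hβ : β ∈ N
    · refine ⟨β, ?_⟩
      ext x; simp only [Finset.mem_inter, Finset.mem_insert, Finset.mem_singleton]; grind
    · refine ⟨γ, ?_⟩
      ext x; simp only [Finset.mem_inter, Finset.mem_insert, Finset.mem_singleton]; grind
  · by_cases hwv : w = v
    · subst hwv
      rw [H.inc_v, Finset.card_eq_one]
      by_cases hβ : β ∈ N
      · refine ⟨δ, ?_⟩
        ext x; simp only [Finset.mem_inter, Finset.mem_insert, Finset.mem_singleton]; grind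
      · refine ⟨γ, ?_⟩
        ext x; simp only [Finset.mem_inter, Finset.mem_insert, Finset.mem_singleton]; grind
    · have hw' : w ∈ reduceVerts W u v := mem_reduceVerts.2 ⟨hwu, hwv, hw⟩
      have hγw : γ ∉ inc w := by
        rw [h.eq_or_eq H.hu H.hv H.huv (x := γ) (by simp [H.inc_u]) (by simp [H.inc_v]) w hw]
        tauto
      rw [← hN w hw', ← Finset.card_image_of_injOn
        ((H.injOn h hw').mono (s₁ := ↑(M ∩ inc w)) (by simp))]
      congr 1
      have hiff : ∀ x ∈ inc w, x ∈ M ↔ reduceMap α β κ δ x ∈ N := by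
        intro x hx
        unfold reduceMap
        split_ifs <;> grind
      ext x
      simp only [Finset.mem_image, Finset.mem_inter, reduceInc]
      constructor
      · rintro ⟨y, ⟨hyM, hyw⟩, rfl⟩
        exact ⟨(hiff y hyw).1 hyM, y, hyw, rfl⟩
      · rintro ⟨hx, y, hyw, rfl⟩
        exact ⟨y, ⟨(hiff y hyw).2 hx, hyw⟩, rfl⟩

/-- The side of a cut of the original graph belonging to a set of vertices of the reduced graph. -/
def _root_.PaperFormalization.expand (u v b : V) (Y : Finset V) : Finset V :=
  if b ∈ Y then insert u (insert v Y) else Y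

theorem expand_subset (H : IsReducible W inc u v a b c d α β γ κ δ) {Y : Finset V}
    (hY : Y ⊆ reduceVerts W u v) : expand u v b Y ⊆ W := by
  have hY' : Y ⊆ W := fun x hx => (mem_reduceVerts.1 (hY hx)).2.2
  unfold expand
  split_ifs
  · intro x hx
    simp only [Finset.mem_insert] at hx
    have := H.hu; have := H.hv
    rcases hx with rfl | rfl | hx
    · assumption
    · assumption
    · exact hY' hx
  · exact hY'

theorem mem_expand {Y : Finset V} (w : V) :
    w ∈ expand u v b Y ↔ w ∈ Y ∨ (b ∈ Y ∧ (w = u ∨ w = v)) := by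
  unfold expand
  split_ifs with h
  · simp only [Finset.mem_insert]; tauto
  · tauto

theorem card_cut (H : IsReducible W inc u v a b c d α β γ κ δ) (h : IsCubic W inc)
    {Y : Finset V} (hY : Y ⊆ reduceVerts W u v) :
    (cut W inc (expand u v b Y)).card + (if ¬ (a ∈ Y ↔ c ∈ Y) then 1 else 0) =
      (cut (reduceVerts W u v) (reduceInc inc α β κ δ) Y).card +
        (if ¬ (a ∈ Y ↔ b ∈ Y) then 1 else 0) + (if ¬ (b ∈ Y ↔ c ∈ Y) then 1 else 0) := by
  obtain ⟨h1, h2, h3, h4, h5, h6, h7, h8, h9, h10⟩ := H.distinct h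
  have hX := H.expand_subset hY
  have ha' : a ∈ reduceVerts W u v := mem_reduceVerts.2 ⟨H.hau, H.hav, H.ha⟩
  have hb' : b ∈ reduceVerts W u v := mem_reduceVerts.2 ⟨H.hbu, H.hbv, H.hb⟩
  have hc' : c ∈ reduceVerts W u v := mem_reduceVerts.2 ⟨H.hcu, H.hcv, H.hc⟩
  have hd' : d ∈ reduceVerts W u v := mem_reduceVerts.2 ⟨H.hdu, H.hdv, H.hd⟩
  have huY : u ∉ Y := fun hh => (mem_reduceVerts.1 (hY hh)).1 rfl
  have hvY : v ∉ Y := fun hh => (mem_reduceVerts.1 (hY hh)).2.1 rfl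
  have hmem := fun y hy => H.mem_reduceInc h (w := y) hy
  have cα := mem_cut_of_ends hX H.hu H.ha (e := α) (by simp [H.inc_u]) H.mem_a
    fun w hw => (h.eq_or_eq H.hu H.ha H.hau.symm (by simp [H.inc_u]) H.mem_a w hw).1
  have cβ := mem_cut_of_ends hX H.hu H.hb (e := β) (by simp [H.inc_u]) H.mem_b
    fun w hw => (h.eq_or_eq H.hu H.hb H.hbu.symm (by simp [H.inc_u]) H.mem_b w hw).1
  have cγ := mem_cut_of_ends hX H.hu H.hv (e := γ) (by simp [H.inc_u]) (by simp [H.inc_v])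
    fun w hw => (h.eq_or_eq H.hu H.hv H.huv (by simp [H.inc_u]) (by simp [H.inc_v]) w hw).1
  have cκ := mem_cut_of_ends hX H.hv H.hc (e := κ) (by simp [H.inc_v]) H.mem_c
    fun w hw => (h.eq_or_eq H.hv H.hc H.hcv.symm (by simp [H.inc_v]) H.mem_c w hw).1
  have cδ := mem_cut_of_ends hX H.hv H.hd (e := δ) (by simp [H.inc_v]) H.mem_d
    fun w hw => (h.eq_or_eq H.hv H.hd H.hdv.symm (by simp [H.inc_v]) H.mem_d w hw).1
  have dα := mem_cut_of_ends hY ha' hc' (e := α) ((hmem a ha').1.2 (Or.inl rfl))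
    ((hmem c hc').1.2 (Or.inr rfl)) fun w hw => (hmem w hw).1.1
  have dβ := mem_cut_of_ends hY hb' hd' (e := β) ((hmem b hb').2.1.2 (Or.inl rfl))
    ((hmem d hd').2.1.2 (Or.inr rfl)) fun w hw => (hmem w hw).2.1.1
  have dγ : γ ∉ cut (reduceVerts W u v) (reduceInc inc α β κ δ) Y := fun hh => by
    obtain ⟨⟨p, hp, hpp⟩, -⟩ := mem_cut.1 hh
    exact (hmem p (hY hp)).2.2.1 hpp
  have dκ : κ ∉ cut (reduceVerts W u v) (reduceInc inc α β κ δ) Y := fun hh => by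
    obtain ⟨⟨p, hp, hpp⟩, -⟩ := mem_cut.1 hh
    exact (hmem p (hY hp)).2.2.2.1 hpp
  have dδ : δ ∉ cut (reduceVerts W u v) (reduceInc inc α β κ δ) Y := fun hh => by
    obtain ⟨⟨p, hp, hpp⟩, -⟩ := mem_cut.1 hh
    exact (hmem p (hY hp)).2.2.2.2.1 hpp
  simp only [mem_expand, huY, hvY, H.hau, H.hav, H.hbu, H.hbv, H.hcu, H.hcv, H.hdu, H.hdv,
    true_or, or_true, or_false, false_or, and_true, and_false] at cα cβ cγ cκ cδ
  have hrest : cut W inc (expand u v b Y) \ {α, β, γ, κ, δ} =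
      cut (reduceVerts W u v) (reduceInc inc α β κ δ) Y \ {α, β, γ, κ, δ} := by
    ext x
    simp only [Finset.mem_sdiff, Finset.mem_insert, Finset.mem_singleton, not_or]
    refine and_congr_left ?_
    rintro ⟨hx1, hx2, hx3, hx4, hx5⟩
    have hm : ∀ w ∈ reduceVerts W u v, (x ∈ reduceInc inc α β κ δ w ↔ x ∈ inc w) := by
      intro w hw
      rw [(hmem w hw).2.2.2.2.2 x hx1 hx2]
      exact and_iff_left ⟨hx3, hx4, hx5⟩
    have hxu : x ∉ inc u := by simp [H.inc_u, hx1, hx2, hx3]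
    have hxv : x ∉ inc v := by simp [H.inc_v, hx3, hx4, hx5]
    simp only [mem_cut]
    constructor
    · rintro ⟨⟨p, hp, hxp⟩, q, hq, hqX, hxq⟩
      rw [mem_expand] at hp hqX
      have hpu : p ≠ u := fun hh => hxu (hh ▸ hxp)
      have hpv : p ≠ v := fun hh => hxv (hh ▸ hxp)
      have hqu : q ≠ u := fun hh => hxu (hh ▸ hxq)
      have hqv : q ≠ v := fun hh => hxv (hh ▸ hxq)
      have hpY : p ∈ Y := hp.resolve_right fun hh => hh.2.elim hpu hpv
      have hq' : q ∈ reduceVerts W u v := mem_reduceVerts.2 ⟨hqu, hqv, hq⟩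
      exact ⟨⟨p, hpY, (hm p (hY hpY)).2 hxp⟩, q, hq', fun hh => hqX (Or.inl hh), (hm q hq').2 hxq⟩
    · rintro ⟨⟨p, hp, hxp⟩, q, hq, hqX, hxq⟩
      rw [hm p (hY hp)] at hxp
      rw [hm q hq] at hxq
      obtain ⟨hqu, hqv, hqW⟩ := mem_reduceVerts.1 hq
      exact ⟨⟨p, (mem_expand p).2 (Or.inl hp), hxp⟩, q, hqW,
        fun hh => ((mem_expand q).1 hh).elim hqX fun hh => hh.2.elim hqu hqv, hxq⟩
  have count : ∀ C : Finset E, C.card = (C \ {α, β, γ, κ, δ}).card +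
      ((if α ∈ C then 1 else 0) + ((if β ∈ C then 1 else 0) + ((if γ ∈ C then 1 else 0) +
        ((if κ ∈ C then 1 else 0) + (if δ ∈ C then 1 else 0))))) := by
    intro C
    rw [← Finset.card_sdiff_add_card_inter C {α, β, γ, κ, δ}]
    congr 1
    rw [Finset.inter_comm, ← Finset.filter_mem_eq_inter, Finset.card_filter,
      Finset.sum_insert (by simp [h1, h2, h7, h8]), Finset.sum_insert (by simp [h3, h9, h10]),
      Finset.sum_insert (by simp [h5.symm, h6.symm]), Finset.sum_insert (by simp [h4]),
      Finset.sum_singleton]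
  rw [count (cut W inc _), count (cut (reduceVerts W u v) _ _), hrest]
  simp only [cα, cβ, cγ, cκ, cδ, dα, dβ, dγ, dκ, dδ]
  by_cases g1 : a ∈ Y <;> by_cases g2 : b ∈ Y <;> by_cases g3 : c ∈ Y <;> by_cases g4 : d ∈ Y <;>
    simp [g1, g2, g3, g4]

end IsReducible

end Reduction

section NoSmallCut

variable {V E ι : Type*} [DecidableEq V] [DecidableEq E]
variable {W : Finset V} {inc : V → Finset E} {O : ι → Finset E} {e : E}

/-- A bridgeless cubic graph on at least six vertices in which every cut of size three is
trivial. -/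
structure IsTight (W : Finset V) (inc : V → Finset E) : Prop where
  cubic : IsCubic W inc
  bridgeless : IsBridgeless W inc
  six_le : 6 ≤ W.card
  trivial_cut : ∀ X ⊆ W, (cut W inc X).card = 3 → X.card ≤ 1 ∨ (W \ X).card ≤ 1

theorem IsCubic.notMem_cut (h : IsCubic W inc) {X : Finset V} (hX : X ⊆ W) {p q : V} {x : E}
    (hp : p ∈ X) (hq : q ∈ X) (hpq : p ≠ q) (hxp : x ∈ inc p) (hxq : x ∈ inc q) :
    x ∈ X.biUnion inc \ cut W inc X := by
  rw [Finset.mem_sdiff, mem_cut_of_ends hX (hX hp) (hX hq) hxp hxq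
    fun w hw => (h.eq_or_eq (hX hp) (hX hq) hpq hxp hxq w hw).1]
  exact ⟨Finset.mem_biUnion.2 ⟨p, hp, hxp⟩, by simp [hp, hq]⟩

theorem IsCubic.exists_third (h : IsCubic W inc) {w : V} (hw : w ∈ W) {x y : E} (hx : x ∈ inc w)
    (hy : y ∈ inc w) (hxy : x ≠ y) : ∃ z, inc w = {x, y, z} := by
  have h3 := h.card_inc w hw
  have hsub : ({x, y} : Finset E) ⊆ inc w := by
    intro s; simp only [Finset.mem_insert, Finset.mem_singleton]; rintro (rfl | rfl) <;> assumption
  have h1 : (inc w \ {x, y}).card = 1 := by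
    rw [Finset.card_sdiff_of_subset hsub, h3, Finset.card_pair hxy]
  obtain ⟨z, hz⟩ := Finset.card_eq_one.1 h1
  refine ⟨z, ?_⟩
  rw [← Finset.sdiff_union_of_subset hsub, hz]
  ext s; simp only [Finset.mem_union, Finset.mem_insert, Finset.mem_singleton]; tauto

theorem IsCubic.exists_ne (h : IsCubic W inc) {w : V} (hw : w ∈ W) (x : E) :
    ∃ y ∈ inc w, y ≠ x := by
  have : 1 < (inc w).card := by rw [h.card_inc w hw]; norm_num
  exact Finset.exists_mem_ne this x

namespace IsTight

theorem three_inside (T : IsTight W inc) {X : Finset V} (hX : X ⊆ W) (h3 : X.card = 3)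
    {x y z : E} (hx : x ∈ X.biUnion inc \ cut W inc X) (hy : y ∈ X.biUnion inc \ cut W inc X)
    (hz : z ∈ X.biUnion inc \ cut W inc X) (hxy : x ≠ y) (hxz : x ≠ z) (hyz : y ≠ z) : False := by
  have h1 := T.cubic.three_mul_card hX
  have h2 : 3 ≤ (X.biUnion inc \ cut W inc X).card := by
    rw [← Finset.card_eq_three.2 ⟨x, y, z, hxy, hxz, hyz, rfl⟩]
    apply Finset.card_le_card
    intro s; simp only [Finset.mem_insert, Finset.mem_singleton]
    rintro (rfl | rfl | rfl) <;> assumption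
  have h4 := T.bridgeless X hX
  have h5 := T.trivial_cut X hX (by omega)
  have h6 := Finset.card_sdiff_of_subset hX
  have h7 := T.six_le
  omega

theorem no_triangle (T : IsTight W inc) {p q r : V} (hp : p ∈ W) (hq : q ∈ W) (hr : r ∈ W)
    (hpq : p ≠ q) (hpr : p ≠ r) (hqr : q ≠ r) {x y z : E} (hxp : x ∈ inc p) (hxq : x ∈ inc q)
    (hyq : y ∈ inc q) (hyr : y ∈ inc r) (hzp : z ∈ inc p) (hzr : z ∈ inc r) : False := by
  have hX : ({p, q, r} : Finset V) ⊆ W := by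
    intro s; simp only [Finset.mem_insert, Finset.mem_singleton]
    rintro (rfl | rfl | rfl) <;> assumption
  have h3 : ({p, q, r} : Finset V).card = 3 := Finset.card_eq_three.2 ⟨p, q, r, hpq, hpr, hqr, rfl⟩
  have mp : p ∈ ({p, q, r} : Finset V) := by simp
  have mq : q ∈ ({p, q, r} : Finset V) := by simp
  have mr : r ∈ ({p, q, r} : Finset V) := by simp
  have ex := T.cubic.eq_or_eq hp hq hpq hxp hxq r hr
  have ey := T.cubic.eq_or_eq hq hr hqr hyq hyr p hp
  refine T.three_inside hX h3 (T.cubic.notMem_cut hX mp mq hpq hxp hxq)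
    (T.cubic.notMem_cut hX mq mr hqr hyq hyr) (T.cubic.notMem_cut hX mp mr hpr hzp hzr) ?_ ?_ ?_
  · rintro rfl; grind
  · rintro rfl; grind
  · rintro rfl; grind

theorem no_digon (T : IsTight W inc) {p q : V} (hp : p ∈ W) (hq : q ∈ W) (hpq : p ≠ q)
    {x y : E} (hxp : x ∈ inc p) (hxq : x ∈ inc q) (hyp : y ∈ inc p) (hyq : y ∈ inc q) :
    x = y := by
  by_contra hxy
  obtain ⟨z, hz⟩ := T.cubic.exists_third hp hxp hyp hxy
  have hzz := T.cubic.card_inc p hp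
  rw [hz] at hzz
  obtain ⟨-, hxz, hyz⟩ := ne_of_card_eq_three hzz
  have hzp : z ∈ inc p := by simp [hz]
  have : ∃ r ∈ W, r ≠ p ∧ r ≠ q ∧ (z ∈ inc q ∨ z ∈ inc r) := by
    obtain ⟨r, hr, hrp, hzr, -⟩ := T.cubic.other p hp z hzp
    by_cases hrq : r = q
    · have hlt : ({p, q} : Finset V).card < W.card := by
        rw [Finset.card_pair hpq]; have := T.six_le; omega
      obtain ⟨s, hs, hs'⟩ := Finset.exists_mem_notMem_of_card_lt_card hlt
      simp only [Finset.mem_insert, Finset.mem_singleton, not_or] at hs'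
      exact ⟨s, hs, hs'.1, hs'.2, Or.inl (hrq ▸ hzr)⟩
    · exact ⟨r, hr, hrp, hrq, Or.inr hzr⟩
  obtain ⟨r, hr, hrp, hrq, hzr⟩ := this
  have hX : ({p, q, r} : Finset V) ⊆ W := by
    intro s; simp only [Finset.mem_insert, Finset.mem_singleton]
    rintro (rfl | rfl | rfl) <;> assumption
  have h3 : ({p, q, r} : Finset V).card = 3 :=
    Finset.card_eq_three.2 ⟨p, q, r, hpq, hrp.symm, Ne.symm hrq, rfl⟩
  have mp : p ∈ ({p, q, r} : Finset V) := by simp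
  have mq : q ∈ ({p, q, r} : Finset V) := by simp
  have mr : r ∈ ({p, q, r} : Finset V) := by simp
  refine T.three_inside hX h3 (T.cubic.notMem_cut hX mp mq hpq hxp hxq)
    (T.cubic.notMem_cut hX mp mq hpq hyp hyq) (z := z) ?_ hxy hxz hyz
  rcases hzr with hzq | hzr
  · exact T.cubic.notMem_cut hX mp mq hpq hzp hzq
  · exact T.cubic.notMem_cut hX mp mr hrp.symm hzp hzr

theorem exists_reducible (T : IsTight W inc) {u v a : V} {α β γ κ δ : E} (hu : u ∈ W) (hv : v ∈ W)
    (ha : a ∈ W) (hau : a ≠ u) (huv : u ≠ v) (hα : α ∈ inc a) (hiu : inc u = {α, β, γ})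
    (hiv : inc v = {γ, κ, δ}) :
    ∃ b c d, IsReducible W inc u v a b c d α β γ κ δ := by
  have c1 := T.cubic.card_inc u hu
  have c2 := T.cubic.card_inc v hv
  rw [hiu] at c1
  rw [hiv] at c2
  obtain ⟨d1, d2, d3⟩ := ne_of_card_eq_three c1
  obtain ⟨d4, d5, d6⟩ := ne_of_card_eq_three c2
  have uα : α ∈ inc u := by simp [hiu]
  have uβ : β ∈ inc u := by simp [hiu]
  have uγ : γ ∈ inc u := by simp [hiu]
  have vγ : γ ∈ inc v := by simp [hiv]
  have vκ : κ ∈ inc v := by simp [hiv]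
  have vδ : δ ∈ inc v := by simp [hiv]
  obtain ⟨b, hb, hbu, hβb, -⟩ := T.cubic.other u hu β uβ
  obtain ⟨c, hc, hcv, hκc, -⟩ := T.cubic.other v hv κ vκ
  obtain ⟨d, hd, hdv, hδd, -⟩ := T.cubic.other v hv δ vδ
  have hav : a ≠ v := by
    rintro rfl; exact d2 (T.no_digon hu hv huv uα hα uγ vγ)
  have hbv : b ≠ v := by
    rintro rfl; exact d3 (T.no_digon hu hv huv uβ hβb uγ vγ)
  have hcu : c ≠ u := by
    rintro rfl; exact d4 (T.no_digon hu hv huv uγ vγ hκc vκ)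
  have hdu : d ≠ u := by
    rintro rfl; exact d5 (T.no_digon hu hv huv uγ vγ hδd vδ)
  refine ⟨b, c, d, hu, hv, ha, hb, hc, hd, huv, hau, hav, hbu, hbv, hcu, hcv, hdu, hdv, ?_, ?_,
    hiu, hiv, hα, hβb, hκc, hδd⟩
  · rintro rfl; exact T.no_triangle hu hv ha huv hau.symm hcv.symm uγ vγ vκ hκc uα hα
  · rintro rfl; exact T.no_triangle hu hv hb huv hbu.symm hbv.symm uγ vγ vδ hδd uβ hβb

theorem card_cut_ne_one (T : IsTight W inc) {W' : Finset V} {inc' : V → Finset E}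
    (h' : IsCubic W' inc') {X Y : Finset V} (hX : X ⊆ W) (hY : Y ⊆ W') (hYX : Y ⊆ X)
    (hYX' : W' \ Y ⊆ W \ X) (hc : (cut W inc X).card = 1 ∨ (cut W inc X).card = 3) :
    (cut W' inc' Y).card ≠ 1 := by
  rcases T.trivial_cut X hX (hc.resolve_left (T.bridgeless X hX)) with h1 | h1
  · exact h'.card_cut_ne_one_of_small hY ((Finset.card_le_card hYX).trans h1)
  · rw [← cut_compl hY]
    exact h'.card_cut_ne_one_of_small Finset.sdiff_subset ((Finset.card_le_card hYX').trans h1)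

end IsTight

namespace IsReducible

variable {u v a b c d : V} {α β γ κ δ : E}

theorem isBridgeless (H : IsReducible W inc u v a b c d α β γ κ δ) (T : IsTight W inc) :
    IsBridgeless (reduceVerts W u v) (reduceInc inc α β κ δ) := by
  intro Y hY h1
  refine T.card_cut_ne_one (H.isCubic T.cubic) (H.expand_subset hY) hY
    (fun w hw => (mem_expand w).2 (Or.inl hw)) ?_ ?_ h1
  · intro w hw
    rw [Finset.mem_sdiff, mem_reduceVerts] at hw
    rw [Finset.mem_sdiff, mem_expand]
    tauto
  · have := H.card_cut T.cubic hY
    rw [h1] at this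
    by_cases g1 : a ∈ Y <;> by_cases g2 : b ∈ Y <;> by_cases g3 : c ∈ Y <;>
      simp [g1, g2, g3] at this <;> omega

/-- The members of the family avoiding the deleted vertices. -/
def _root_.PaperFormalization.restrictFamily (inc : V → Finset E) (u v : V) (O : ι → Finset E)
    (i : ι) : Finset E :=
  if O i ∩ inc u = ∅ ∧ O i ∩ inc v = ∅ then O i else ∅

theorem ne_of_mem (H : IsReducible W inc u v a b c d α β γ κ δ) {i : ι}
    (h1 : O i ∩ inc u = ∅) (h2 : O i ∩ inc v = ∅) {x : E} (hx : x ∈ O i) :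
    x ≠ α ∧ x ≠ β ∧ x ≠ γ ∧ x ≠ κ ∧ x ≠ δ := by
  rw [H.inc_u] at h1
  rw [H.inc_v] at h2
  rw [Finset.eq_empty_iff_forall_notMem] at h1 h2
  have h1 := h1 x
  have h2 := h2 x
  simp only [Finset.mem_inter, Finset.mem_insert, Finset.mem_singleton] at h1 h2
  tauto

theorem isEvenFamily (H : IsReducible W inc u v a b c d α β γ κ δ) (h : IsCubic W inc)
    (hO : IsEvenFamily W inc O) :
    IsEvenFamily (reduceVerts W u v) (reduceInc inc α β κ δ) (restrictFamily inc u v O) := by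
  refine ⟨fun i j hij => ?_, fun i w hw => ?_, fun i x hx => ?_⟩
  · refine (hO.disj i j hij).mono ?_ ?_ <;> unfold restrictFamily <;> split_ifs <;> simp
  · unfold restrictFamily
    split_ifs with hi
    · have : O i ∩ reduceInc inc α β κ δ w = O i ∩ inc w := by
        ext x
        rw [Finset.mem_inter, Finset.mem_inter]
        refine and_congr_right fun hx => ?_
        obtain ⟨h1, h2, h3⟩ := H.ne_of_mem hi.1 hi.2 hx
        rw [(H.mem_reduceInc h hw).2.2.2.2.2 x h1 h2]
        exact and_iff_left h3
      rw [this]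
      exact hO.even i w (mem_reduceVerts.1 hw).2.2
    · simp
  · unfold restrictFamily at hx
    split_ifs at hx with hi
    · obtain ⟨h1, h2, h3⟩ := H.ne_of_mem hi.1 hi.2 hx
      obtain ⟨w, hw, hxw⟩ := Finset.mem_biUnion.1 (hO.subset i hx)
      have hw' : w ∈ reduceVerts W u v := by
        refine mem_reduceVerts.2 ⟨?_, ?_, hw⟩
        · rintro rfl
          exact Finset.notMem_empty x (hi.1 ▸ Finset.mem_inter.2 ⟨hx, hxw⟩)
        · rintro rfl
          exact Finset.notMem_empty x (hi.2 ▸ Finset.mem_inter.2 ⟨hx, hxw⟩)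
      exact Finset.mem_biUnion.2 ⟨w, hw', ((H.mem_reduceInc h hw').2.2.2.2.2 x h1 h2).2 ⟨hxw, h3⟩⟩
    · simp at hx

theorem lift_hitting (H : IsReducible W inc u v a b c d α β γ κ δ) (h : IsCubic W inc)
    {N : Finset E} (hN : IsPerfectMatching (reduceVerts W u v) (reduceInc inc α β κ δ) N)
    (heN : e ∈ N) (hea : e ∈ reduceInc inc α β κ δ a) (heα : e ≠ α)
    (hNO : ∀ i, Odd (restrictFamily inc u v O i).card → (N ∩ restrictFamily inc u v O i).Nonempty)
    (hT : ∀ i, (O i ∩ inc u).Nonempty ∨ (O i ∩ inc v).Nonempty → (γ ∈ O i ∧ δ ∈ O i) ∨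
      ∃ x ∈ N, x ∈ O i ∧ x ≠ γ ∧ x ≠ κ ∧ x ≠ δ) :
    ∃ M, IsPerfectMatching W inc M ∧ e ∈ M ∧ (∀ i, Odd (O i).card → (M ∩ O i).Nonempty) ∧
      (γ ∈ M ∨ δ ∈ M) := by
  obtain ⟨M, hM, hNM, hγδ⟩ := H.lift h hN heN hea heα
  have ha' : a ∈ reduceVerts W u v := mem_reduceVerts.2 ⟨H.hau, H.hav, H.ha⟩
  obtain ⟨-, -, m3, m4, m5, -⟩ := H.mem_reduceInc h ha'
  refine ⟨M, hM, hNM e heN ?_ ?_ ?_, fun i hi => ?_, hγδ⟩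
  · rintro rfl; exact m3 hea
  · rintro rfl; exact m4 hea
  · rintro rfl; exact m5 hea
  · by_cases hi' : O i ∩ inc u = ∅ ∧ O i ∩ inc v = ∅
    · have hr : restrictFamily inc u v O i = O i := if_pos hi'
      have := hNO i
      rw [hr] at this
      obtain ⟨x, hx⟩ := this hi
      rw [Finset.mem_inter] at hx
      obtain ⟨-, -, h3, h4, h5⟩ := H.ne_of_mem hi'.1 hi'.2 hx.2
      exact ⟨x, Finset.mem_inter.2 ⟨hNM x hx.1 h3 h4 h5, hx.2⟩⟩
    · rw [not_and_or, ← Ne, ← Ne, ← Finset.nonempty_iff_ne_empty,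
        ← Finset.nonempty_iff_ne_empty] at hi'
      rcases hT i hi' with ⟨h1, h2⟩ | ⟨x, hxN, hxO, h3, h4, h5⟩
      · rcases hγδ with h | h
        · exact ⟨γ, Finset.mem_inter.2 ⟨h, h1⟩⟩
        · exact ⟨δ, Finset.mem_inter.2 ⟨h, h2⟩⟩
      · exact ⟨x, Finset.mem_inter.2 ⟨hNM x hxN h3 h4 h5, hxO⟩⟩

end IsReducible

end NoSmallCut

section CubicTheorem

variable {V E ι : Type*} [DecidableEq V] [DecidableEq E]
variable {W : Finset V} {inc : V → Finset E} {O : ι → Finset E} {e : E}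

theorem IsCubic.exists_other_mem (h : IsCubic W inc) (hO : IsEvenFamily W inc O) {i : ι} {w : V}
    (hw : w ∈ W) {x : E} (hx : x ∈ O i) (hxw : x ∈ inc w) : ∃ y ∈ O i, y ∈ inc w ∧ y ≠ x := by
  have hx' : x ∈ O i ∩ inc w := Finset.mem_inter.2 ⟨hx, hxw⟩
  have h2 := (h.card_inter_inc hO i hw).resolve_left (Finset.card_ne_zero_of_mem hx')
  obtain ⟨y, hy, hyx⟩ := Finset.exists_mem_ne (by omega : 1 < (O i ∩ inc w).card) x
  rw [Finset.mem_inter] at hy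
  exact ⟨y, hy.1, hy.2, hyx⟩

theorem IsCubic.inter_inc_eq_empty (h : IsCubic W inc) (hO : IsEvenFamily W inc O) {i j : ι}
    (hij : j ≠ i) {w : V} (hw : w ∈ W) (hi : (O i ∩ inc w).Nonempty) : O j ∩ inc w = ∅ := by
  have h2 := (h.card_inter_inc hO i hw).resolve_left (Finset.card_ne_zero.2 hi)
  rcases h.card_inter_inc hO j hw with h0 | h0
  · exact Finset.card_eq_zero.1 h0
  · exfalso
    have hd : Disjoint (O i ∩ inc w) (O j ∩ inc w) :=
      (hO.disj i j hij.symm).mono Finset.inter_subset_left Finset.inter_subset_left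
    have := Finset.card_le_card (Finset.union_subset (Finset.inter_subset_right (s₁ := O i)
      (s₂ := inc w)) (Finset.inter_subset_right (s₁ := O j) (s₂ := inc w)))
    rw [Finset.card_union_of_disjoint hd, h.card_inc w hw] at this
    omega

theorem IsCubic.notMem_third (h : IsCubic W inc) (hO : IsEvenFamily W inc O) {i : ι} {w : V}
    (hw : w ∈ W) {x y z : E} (hx : x ∈ O i) (hy : y ∈ O i) (hi : inc w = {x, y, z}) :
    z ∉ O i := by
  intro hz
  have h3 := h.card_inc w hw
  have : O i ∩ inc w = inc w := by
    rw [Finset.inter_eq_right, hi]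
    intro s; simp only [Finset.mem_insert, Finset.mem_singleton]
    rintro (rfl | rfl | rfl) <;> assumption
  rcases h.card_inter_inc hO i hw with h0 | h0 <;> rw [this] at h0 <;> omega

theorem card_reduceVerts_lt {u v : V} (hu : u ∈ W) : (reduceVerts W u v).card < W.card :=
  Finset.card_lt_card (Finset.ssubset_iff_of_subset
    (fun _ hw => (mem_reduceVerts.1 hw).2.2) |>.2 ⟨u, hu, fun h => (mem_reduceVerts.1 h).1 rfl⟩)

theorem IsReducible.mem_reduceInc_of_tight {u v a b c d : V} {α β γ κ δ : E}
    (H : IsReducible W inc u v a b c d α β γ κ δ) (T : IsTight W inc) (hea : e ∈ inc a)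
    (heα : e ≠ α) : e ∉ inc u ∧ e ∉ inc v ∧ e ∈ reduceInc inc α β κ δ a := by
  have h1 : e ∉ inc u := fun h =>
    heα (T.no_digon H.hu H.ha H.hau.symm h hea (by simp [H.inc_u]) H.mem_a)
  have h2 : e ∉ inc v := fun h =>
    T.no_triangle H.hu H.hv H.ha H.huv H.hau.symm H.hav.symm (x := γ) (y := e) (z := α)
      (by simp [H.inc_u]) (by simp [H.inc_v]) h hea (by simp [H.inc_u]) H.mem_a
  refine ⟨h1, h2, ?_⟩
  rw [H.inc_u] at h1
  rw [H.inc_v] at h2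
  simp only [Finset.mem_insert, Finset.mem_singleton, not_or] at h1 h2
  have ha' : a ∈ reduceVerts W u v := mem_reduceVerts.2 ⟨H.hau, H.hav, H.ha⟩
  exact ((H.mem_reduceInc T.cubic ha').2.2.2.2.2 e h1.1 h1.2.1).2 ⟨hea, h1.2.2, h2.2⟩

/-- Every smaller instance has a hitting matching. -/
def SolvableBelow (n : ℕ) (V E ι : Type*) [DecidableEq V] [DecidableEq E] : Prop :=
  ∀ (W : Finset V) (inc : V → Finset E) (O : ι → Finset E) (e : E), W.card < n →
    IsCubic W inc → IsBridgeless W inc → IsEvenFamily W inc O → e ∈ W.biUnion inc →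
      HasHittingMatching W inc O e

theorem IsTight.hasHittingMatching_of_reducible (T : IsTight W inc)
    (hS : SolvableBelow W.card V E ι) (hO : IsEvenFamily W inc O)
    {u v a b c d : V} {α β γ κ δ : E} (H : IsReducible W inc u v a b c d α β γ κ δ)
    (hea : e ∈ inc a) (heα : e ≠ α)
    (hT : ∀ i, (O i ∩ inc u).Nonempty ∨ (O i ∩ inc v).Nonempty → γ ∈ O i ∧ δ ∈ O i) :
    HasHittingMatching W inc O e := by
  obtain ⟨-, -, he⟩ := H.mem_reduceInc_of_tight T hea heα
  obtain ⟨N, hN, heN, hNO⟩ := hS (reduceVerts W u v) (reduceInc inc α β κ δ)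
    (restrictFamily inc u v O) e (card_reduceVerts_lt H.hu) (H.isCubic T.cubic) (H.isBridgeless T)
    (H.isEvenFamily T.cubic hO)
    (Finset.mem_biUnion.2 ⟨a, mem_reduceVerts.2 ⟨H.hau, H.hav, H.ha⟩, he⟩)
  obtain ⟨M, hM, heM, hMO, -⟩ :=
    H.lift_hitting T.cubic hN heN he heα hNO fun i hi => Or.inl (hT i hi)
  exact ⟨M, hM, heM, hMO⟩

/-- The case of a family member passing through a vertex at distance one from `e`. -/
theorem IsTight.hasHittingMatching_of_touched (T : IsTight W inc)
    (hS : SolvableBelow W.card V E ι) (hO : IsEvenFamily W inc O)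
    {a u : V} (ha : a ∈ W) (hu : u ∈ W) (hau : a ≠ u) {α : E} (hea : e ∈ inc a)
    (hαa : α ∈ inc a) (hαu : α ∈ inc u) (heα : e ≠ α) {i : ι} (hi : (O i ∩ inc u).Nonempty) :
    HasHittingMatching W inc O e := by
  have hγ : ∃ γ ∈ O i, γ ∈ inc u ∧ γ ≠ α := by
    obtain ⟨x, hx⟩ := hi
    rw [Finset.mem_inter] at hx
    obtain ⟨y, hy, hyu, hyx⟩ := T.cubic.exists_other_mem hO hu hx.1 hx.2
    by_cases h : x = α
    · exact ⟨y, hy, hyu, h ▸ hyx⟩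
    · exact ⟨x, hx.1, hx.2, h⟩
  obtain ⟨γ, hγi, hγu, hγα⟩ := hγ
  obtain ⟨v, hv, hvu, hγv, -⟩ := T.cubic.other u hu γ hγu
  obtain ⟨δ, hδi, hδv, hδγ⟩ := T.cubic.exists_other_mem hO hv hγi hγv
  obtain ⟨β, hβ⟩ := T.cubic.exists_third hu hαu hγu hγα.symm
  obtain ⟨κ, hκ⟩ := T.cubic.exists_third hv hγv hδv hδγ.symm
  have hβ' : inc u = {α, β, γ} := by rw [hβ, Finset.pair_comm]
  have hκ' : inc v = {γ, κ, δ} := by rw [hκ, Finset.pair_comm]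
  obtain ⟨b, c, d, H⟩ := T.exists_reducible hu hv ha hau hvu.symm hαa hβ' hκ'
  refine T.hasHittingMatching_of_reducible hS hO H hea heα fun j hj => ?_
  have hij : j = i := by
    by_contra hij
    have h1 := T.cubic.inter_inc_eq_empty hO hij hu hi
    have h2 := T.cubic.inter_inc_eq_empty hO hij hv ⟨γ, Finset.mem_inter.2 ⟨hγi, hγv⟩⟩
    simp [h1, h2] at hj
  subst hij
  exact ⟨hγi, hδi⟩

/-- The case of a family member passing through a vertex at distance two from `e`. -/
theorem IsTight.hasHittingMatching_of_touched_of_untouched (T : IsTight W inc)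
    (hS : SolvableBelow W.card V E ι) (hO : IsEvenFamily W inc O)
    {u v a b c d : V} {α β γ κ δ : E} (H : IsReducible W inc u v a b c d α β γ κ δ)
    (hea : e ∈ inc a) (heα : e ≠ α)
    (hE : ∀ y ∈ W, e ∈ inc y → ∀ i, O i ∩ inc y = ∅)
    (hA : ∀ y ∈ W, ∀ f ∈ inc a, f ∈ inc y → ∀ i, O i ∩ inc y = ∅)
    {i : ι} (hκ : κ ∈ O i) (hδ : δ ∈ O i) : HasHittingMatching W inc O e := by
  have h := T.cubic
  have h1 := H.isCubic h
  obtain ⟨D1, D2, D3, D4, D5, D6, D7, D8, D9, D10⟩ := H.distinct h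
  have huO : ∀ j, O j ∩ inc u = ∅ := hA u H.hu α H.mem_a (by simp [H.inc_u])
  have touched : ∀ {w x}, x ∈ O i → x ∈ inc w → O i ∩ inc w = ∅ → False := fun hx hxw h0 =>
    Finset.notMem_empty _ (h0 ▸ Finset.mem_inter.2 ⟨hx, hxw⟩)
  have hκv : κ ∈ inc v := by simp [H.inc_v]
  have hδv : δ ∈ inc v := by simp [H.inc_v]
  obtain ⟨μ, hμ, hμc, hμκ⟩ := h.exists_other_mem hO H.hc hκ H.mem_c
  obtain ⟨ω, hω⟩ := h.exists_third H.hc H.mem_c hμc hμκ.symm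
  have hωc : ω ∈ inc c := by simp [hω]
  have hcc := h.card_inc c H.hc
  rw [hω] at hcc
  obtain ⟨-, hκω, hμω⟩ := ne_of_card_eq_three hcc
  obtain ⟨s, hs, hsc, hμs, -⟩ := h.other c H.hc μ hμc
  obtain ⟨ν, hν, hνs, hνμ⟩ := h.exists_other_mem hO hs hμ hμs
  obtain ⟨ρ, hρ⟩ := h.exists_third hs hμs hνs hνμ.symm
  have hρs : ρ ∈ inc s := by simp [hρ]
  have hcs := h.card_inc s hs
  rw [hρ] at hcs
  obtain ⟨-, hμρ, hνρ⟩ := ne_of_card_eq_three hcs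
  have hρO := h.notMem_third hO hs hμ hν hρ
  have hsv : s ≠ v := by
    rintro rfl; exact hμκ (T.no_digon H.hc hs hsc.symm hμc hμs H.mem_c hκv)
  have hsu : s ≠ u := by
    rintro rfl; exact touched hμ hμs (huO i)
  have hcd : c ≠ d := fun hcd =>
    D4 (T.no_digon H.hc H.hv H.hcv H.mem_c hκv (hcd ▸ H.mem_d) hδv)
  have hsd : s ≠ d := fun hsd =>
    T.no_triangle H.hv H.hc hs H.hcv.symm hsv.symm hsc.symm hκv H.mem_c hμc hμs hδv
      (hsd ▸ H.mem_d)
  have hcb : c ≠ b := fun hcb =>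
    T.no_triangle H.hu H.hv H.hc H.huv H.hcu.symm H.hcv.symm (x := γ) (y := κ) (z := β)
      (by simp [H.inc_u]) (by simp [H.inc_v]) hκv H.mem_c (by simp [H.inc_u]) (hcb ▸ H.mem_b)
  have hab : a ≠ b := fun hab =>
    D1 (T.no_digon H.hu H.ha H.hau.symm (by simp [H.inc_u]) H.mem_a (by simp [H.inc_u])
      (hab ▸ H.mem_b))
  have had : a ≠ d := fun had =>
    T.no_triangle H.hu H.hv H.ha H.huv H.hau.symm H.hav.symm (x := γ) (y := δ) (z := α)
      (by simp [H.inc_u]) (by simp [H.inc_v]) hδv (had ▸ H.mem_d) (by simp [H.inc_u]) H.mem_a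
  have hsa : s ≠ a := by
    rintro rfl; exact touched hμ hμs (hA s hs α H.mem_a H.mem_a i)
  have hmem := fun y hy => H.mem_reduceInc h (w := y) hy
  have ha' : a ∈ reduceVerts W u v := mem_reduceVerts.2 ⟨H.hau, H.hav, H.ha⟩
  have hc' : c ∈ reduceVerts W u v := mem_reduceVerts.2 ⟨H.hcu, H.hcv, H.hc⟩
  have hs' : s ∈ reduceVerts W u v := mem_reduceVerts.2 ⟨hsu, hsv, hs⟩
  have hκends := h.eq_or_eq H.hv H.hc H.hcv.symm hκv H.mem_c
  have hδends := h.eq_or_eq H.hv H.hd H.hdv.symm hδv H.mem_d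
  have hδc : δ ∉ inc c := by
    rw [hδends c H.hc]; exact not_or.2 ⟨H.hcv, hcd⟩
  have hδs : δ ∉ inc s := by
    rw [hδends s hs]; exact not_or.2 ⟨hsv, hsd⟩
  have hκs : κ ∉ inc s := by
    rw [hκends s hs]; exact not_or.2 ⟨hsv, hsc⟩
  have hfix : ∀ x, x ≠ κ → x ≠ δ → reduceMap α β κ δ x = x := fun x hx1 hx2 => by
    simp [reduceMap, hx1, hx2]
  have hμδ : μ ≠ δ := fun hh => hδc (hh ▸ hμc)
  have hωδ : ω ≠ δ := fun hh => hδc (hh ▸ hωc)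
  have hνκ : ν ≠ κ := fun hh => hκs (hh ▸ hνs)
  have hνδ : ν ≠ δ := fun hh => hδs (hh ▸ hνs)
  have hρκ : ρ ≠ κ := fun hh => hκs (hh ▸ hρs)
  have hρδ : ρ ≠ δ := fun hh => hδs (hh ▸ hρs)
  have hic : reduceInc inc α β κ δ c = {α, ω, μ} := by
    rw [reduceInc, hω, Finset.image_insert, Finset.image_insert, Finset.image_singleton,
      hfix μ hμκ hμδ, hfix ω hκω.symm hωδ, Finset.pair_comm]
    simp [reduceMap]
  have his : reduceInc inc α β κ δ s = {μ, ρ, ν} := by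
    rw [reduceInc, hρ, Finset.image_insert, Finset.image_insert, Finset.image_singleton,
      hfix μ hμκ hμδ, hfix ν hνκ hνδ, hfix ρ hρκ hρδ, Finset.pair_comm]
  have hic3 := h1.card_inc c hc'
  rw [hic] at hic3
  obtain ⟨hαω, hαμ, -⟩ := ne_of_card_eq_three hic3
  have hαs : α ∉ reduceInc inc α β κ δ s := by
    rw [(hmem s hs').1]; exact not_or.2 ⟨hsa, hsc⟩
  have hαν : α ≠ ν := by rintro rfl; exact hαs (by simp [his])
  have hαρ : α ≠ ρ := by rintro rfl; exact hαs (by simp [his])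
  have hβc : β ∉ reduceInc inc α β κ δ c := by
    rw [(hmem c hc').2.1]; exact not_or.2 ⟨hcb, hcd⟩
  have hβω : β ≠ ω := by rintro rfl; exact hβc (by simp [hic])
  have hβν : β ≠ ν := by
    rintro rfl; exact touched hν (by simp [H.inc_u]) (huO i)
  have hωs : ω ∉ inc s := fun hh =>
    hμω (T.no_digon H.hc hs hsc.symm hμc hμs hωc hh)
  have hωs' : ω ∉ reduceInc inc α β κ δ s := by
    rw [(hmem s hs').2.2.2.2.2 ω hαω.symm hβω.symm]; exact fun hh => hωs hh.1
  obtain ⟨p, hp, hpc, hωp, -⟩ := h1.other c hc' ω (by simp [hic])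
  obtain ⟨g, hg, hgs, hρg, -⟩ := h1.other s hs' ρ (by simp [his])
  obtain ⟨q, hq, hqs, hνq, -⟩ := h1.other s hs' ν (by simp [his])
  have hps : p ≠ s := fun hh => hωs' (hh ▸ hωp)
  have hgc : g ≠ c := by
    rintro rfl
    rw [hic] at hρg
    simp only [Finset.mem_insert, Finset.mem_singleton] at hρg
    rcases hρg with hh | hh | hh
    · exact hαρ hh.symm
    · exact hωs (hh ▸ hρs)
    · exact hμρ hh.symm
  have hqc : q ≠ c := by
    rintro rfl
    rw [hic] at hνq
    simp only [Finset.mem_insert, Finset.mem_singleton] at hνq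
    rcases hνq with hh | hh | hh
    · exact hαν hh.symm
    · exact hωs (hh ▸ hνs)
    · exact hνμ hh
  have hag : a ≠ g := by
    rintro rfl
    by_cases hρβ : ρ = β
    · rw [hρβ, (hmem a ha').2.1] at hρg
      exact hρg.elim hab had
    · rw [(hmem a ha').2.2.2.2.2 ρ hαρ.symm hρβ] at hρg
      exact touched hμ hμs (hA s hs ρ hρg.1 hρs i)
  have hpq : p ≠ q := by
    rintro rfl
    rw [(hmem p hp).2.2.2.2.2 ω hαω.symm hβω.symm] at hωp
    rw [(hmem p hp).2.2.2.2.2 ν hαν.symm hβν.symm] at hνq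
    exact T.no_triangle H.hc hs (mem_reduceVerts.1 hp).2.2 hsc.symm hpc.symm hps.symm hμc hμs hνs
      hνq.1 hωc hωp.1
  have H2 : IsReducible (reduceVerts W u v) (reduceInc inc α β κ δ) c s a p g q α ω μ ρ ν :=
    ⟨hc', hs', ha', hp, hg, hq, hsc.symm, H.hac, hsa.symm, hpc, hps, hgc, hgs, hqc, hqs, hag, hpq,
      hic, his, (hmem a ha').1.2 (Or.inl rfl), hωp, hρg, hνq⟩
  have h2 := H2.isCubic h1
  have hb2 : IsBridgeless (reduceVerts (reduceVerts W u v) c s)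
      (reduceInc (reduceInc inc α β κ δ) α ω ρ ν) := by
    intro Y hY hcut
    have hX := H2.expand_subset hY
    refine T.card_cut_ne_one h2 (H.expand_subset hX) hY (fun w hw =>
      (IsReducible.mem_expand w).2 (Or.inl ((IsReducible.mem_expand w).2 (Or.inl hw)))) ?_ ?_ hcut
    · intro w hw
      rw [Finset.mem_sdiff, mem_reduceVerts, mem_reduceVerts] at hw
      rw [Finset.mem_sdiff, IsReducible.mem_expand, IsReducible.mem_expand]
      tauto
    · have g1 := H.card_cut h hX
      have g2 := H2.card_cut h1 hY
      have ga : a ∈ expand c s p Y ↔ a ∈ Y := by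
        rw [IsReducible.mem_expand]
        exact or_iff_left fun hh => hh.2.elim H.hac hsa.symm
      have gc : c ∈ expand c s p Y ↔ p ∈ Y := by
        rw [IsReducible.mem_expand]
        have : c ∉ Y := fun hh => (mem_reduceVerts.1 (hY hh)).1 rfl
        simp [this]
      rw [hcut] at g2
      simp only [ga, gc] at g1
      by_cases k1 : a ∈ Y <;> by_cases k2 : p ∈ Y <;> by_cases k3 : g ∈ Y <;>
        by_cases k4 : b ∈ expand c s p Y <;> simp [k1, k2, k3, k4] at g1 g2 <;> omega
  obtain ⟨-, -, he1⟩ := H.mem_reduceInc_of_tight T hea heα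
  have hec : e ∉ inc c := fun hh => touched hκ H.mem_c (hE c H.hc hh i)
  have hes : e ∉ inc s := fun hh => touched hμ hμs (hE s hs hh i)
  have hne : ∀ x, x ∈ inc c ∨ x ∈ inc s → e ≠ x := by
    rintro x (hx | hx) rfl <;> contradiction
  have he2 : e ∈ reduceInc (reduceInc inc α β κ δ) α ω ρ ν a := by
    rw [(H2.mem_reduceInc h1 (mem_reduceVerts.2 ⟨H.hac, hsa.symm, ha'⟩)).2.2.2.2.2 e heα
      (hne ω (Or.inl hωc))]
    exact ⟨he1, hne μ (Or.inl hμc), hne ρ (Or.inr hρs), hne ν (Or.inr hνs)⟩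
  have hiv : (O i ∩ inc v).Nonempty := ⟨κ, Finset.mem_inter.2 ⟨hκ, hκv⟩⟩
  have hic' : (O i ∩ inc c).Nonempty := ⟨κ, Finset.mem_inter.2 ⟨hκ, H.mem_c⟩⟩
  have his' : (O i ∩ inc s).Nonempty := ⟨μ, Finset.mem_inter.2 ⟨hμ, hμs⟩⟩
  have hO1 := H.isEvenFamily h hO
  have hi0 : restrictFamily inc u v O i = ∅ := if_neg fun hh => hiv.ne_empty hh.2
  have hsub : ∀ j, restrictFamily inc u v O j ⊆ O j := fun j => by
    unfold restrictFamily; split_ifs <;> simp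
  have hunt : ∀ j, restrictFamily inc u v O j ∩ reduceInc inc α β κ δ c = ∅ ∧
      restrictFamily inc u v O j ∩ reduceInc inc α β κ δ s = ∅ := by
    intro j
    by_cases hji : j = i
    · subst hji; simp [hi0]
    · have hc0 := h.inter_inc_eq_empty hO hji H.hc hic'
      have hs0 := h.inter_inc_eq_empty hO hji hs his'
      have hu0 := huO j
      rw [Finset.eq_empty_iff_forall_notMem] at hc0 hs0 hu0
      have hα0 : α ∉ O j := fun hh => hu0 α (Finset.mem_inter.2 ⟨hh, by simp [H.inc_u]⟩)
      constructor
      · rw [Finset.eq_empty_iff_forall_notMem, hic]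
        intro x hx
        simp only [Finset.mem_inter, Finset.mem_insert, Finset.mem_singleton] at hx
        obtain ⟨hx, rfl | rfl | rfl⟩ := hx
        · exact hα0 (hsub j hx)
        · exact hc0 _ (Finset.mem_inter.2 ⟨hsub j hx, hωc⟩)
        · exact hc0 _ (Finset.mem_inter.2 ⟨hsub j hx, hμc⟩)
      · rw [Finset.eq_empty_iff_forall_notMem, his]
        intro x hx
        simp only [Finset.mem_inter, Finset.mem_insert, Finset.mem_singleton] at hx
        obtain ⟨hx, rfl | rfl | rfl⟩ := hx
        · exact hs0 _ (Finset.mem_inter.2 ⟨hsub j hx, hμs⟩)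
        · exact hs0 _ (Finset.mem_inter.2 ⟨hsub j hx, hρs⟩)
        · exact hs0 _ (Finset.mem_inter.2 ⟨hsub j hx, hνs⟩)
  obtain ⟨N, hN, heN, hNO⟩ := hS _ _ _ e
    ((card_reduceVerts_lt H2.hu).trans (card_reduceVerts_lt H.hu)) h2 hb2
    (H2.isEvenFamily h1 hO1)
    (Finset.mem_biUnion.2 ⟨a, mem_reduceVerts.2 ⟨H.hac, hsa.symm, ha'⟩, he2⟩)
  obtain ⟨M₁, hM₁, heM₁, hMO₁, hμν⟩ := H2.lift_hitting h1 hN heN he2 heα hNO fun j hj => by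
    rw [(hunt j).1, (hunt j).2] at hj
    simp at hj
  obtain ⟨M, hM, heM, hMO, -⟩ := H.lift_hitting h hM₁ heM₁ he1 heα hMO₁ fun j hj => by
    have hji : j = i := by
      by_contra hji
      rw [huO j, h.inter_inc_eq_empty hO hji H.hv hiv] at hj
      simp at hj
    subst hji
    right
    have hγO : γ ∉ O j := fun hh => touched hh (by simp [H.inc_u]) (huO j)
    rcases hμν with hh | hh
    · exact ⟨μ, hh, hμ, fun h' => hγO (h' ▸ hμ), hμκ, hμδ⟩
    · exact ⟨ν, hh, hν, fun h' => hγO (h' ▸ hν), hνκ, hνδ⟩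
  exact ⟨M, hM, heM, hMO⟩

theorem IsTight.hasHittingMatching (T : IsTight W inc)
    (hS : SolvableBelow W.card V E ι) (hO : IsEvenFamily W inc O) (heO : ∀ i, e ∉ O i)
    (he : e ∈ W.biUnion inc) : HasHittingMatching W inc O e := by
  have h := T.cubic
  by_cases hC : ∃ p ∈ W, ∃ q ∈ W, p ≠ q ∧ e ∈ inc p ∧
      ∃ f, f ∈ inc p ∧ f ∈ inc q ∧ e ≠ f ∧ ∃ i, (O i ∩ inc q).Nonempty
  · obtain ⟨p, hp, q, hq, hpq, hep, f, hfp, hfq, hef, i, hi⟩ := hC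
    exact T.hasHittingMatching_of_touched hS hO hp hq hpq hep hfp hfq hef hi
  push Not at hC
  have hE : ∀ y ∈ W, e ∈ inc y → ∀ i, O i ∩ inc y = ∅ := by
    intro y hy hey i
    rw [Finset.eq_empty_iff_forall_notMem]
    intro x hx
    rw [Finset.mem_inter] at hx
    obtain ⟨z, hz, hzy, hxz, -⟩ := h.other y hy x hx.2
    have := hC y hy z hz hzy.symm hey x hx.2 hxz (fun hh => heO i (hh ▸ hx.1)) i
    exact Finset.notMem_empty x (this ▸ Finset.mem_inter.2 ⟨hx.1, hxz⟩)
  obtain ⟨a, ha, hea⟩ := Finset.mem_biUnion.1 he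
  have hA : ∀ y ∈ W, ∀ f ∈ inc a, f ∈ inc y → ∀ i, O i ∩ inc y = ∅ := by
    intro y hy f hfa hfy i
    by_cases hef : e = f
    · exact hE y hy (hef ▸ hfy) i
    · by_cases hay : a = y
      · exact hE y hy (hay ▸ hea) i
      · exact hC a ha y hy hay hea f hfa hfy hef i
  obtain ⟨α, hαa, hαe⟩ := h.exists_ne ha e
  obtain ⟨u, hu, hua, hαu, -⟩ := h.other a ha α hαa
  obtain ⟨γ, hγu, hγα⟩ := h.exists_ne hu α
  obtain ⟨v, hv, hvu, hγv, -⟩ := h.other u hu γ hγu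
  obtain ⟨β, hβ⟩ := h.exists_third hu hαu hγu hγα.symm
  have hβ' : inc u = {α, β, γ} := by rw [hβ, Finset.pair_comm]
  have huO := hA u hu α hαa hαu
  by_cases hvO : ∃ i, (O i ∩ inc v).Nonempty
  · obtain ⟨i, κ, hκ⟩ := hvO
    rw [Finset.mem_inter] at hκ
    obtain ⟨δ, hδ, hδv, hδκ⟩ := h.exists_other_mem hO hv hκ.1 hκ.2
    obtain ⟨γ', hγ'⟩ := h.exists_third hv hκ.2 hδv hδκ.symm
    have hγO : γ ∉ O i := fun hh =>
      Finset.notMem_empty γ (huO i ▸ Finset.mem_inter.2 ⟨hh, hγu⟩)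
    have hγγ : γ = γ' := by
      have := hγv
      rw [hγ'] at this
      simp only [Finset.mem_insert, Finset.mem_singleton] at this
      rcases this with hh | hh | hh
      · exact absurd (hh ▸ hκ.1) hγO
      · exact absurd (hh ▸ hδ) hγO
      · exact hh
    subst hγγ
    have hκ' : inc v = {γ, κ, δ} := by
      rw [hγ']; ext x; simp only [Finset.mem_insert, Finset.mem_singleton]; tauto
    obtain ⟨b, c, d, H⟩ := T.exists_reducible hu hv ha hua.symm hvu.symm hαa hβ' hκ'
    exact T.hasHittingMatching_of_touched_of_untouched hS hO H hea hαe.symm hE hA hκ.1 hδ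
  · push Not at hvO
    obtain ⟨κ, hκv, hκγ⟩ := h.exists_ne hv γ
    obtain ⟨δ, hδ⟩ := h.exists_third hv hγv hκv hκγ.symm
    obtain ⟨b, c, d, H⟩ := T.exists_reducible hu hv ha hua.symm hvu.symm hαa hβ' hδ
    refine T.hasHittingMatching_of_reducible hS hO H hea hαe.symm fun i hi => ?_
    rw [huO i, hvO i] at hi
    simp at hi

/-- In a bridgeless cubic graph every edge lies in a perfect matching meeting every odd member of
a given family of edge-disjoint even subgraphs. -/
theorem hasHittingMatching (W : Finset V) (inc : V → Finset E) (O : ι → Finset E) (e : E)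
    (h : IsCubic W inc) (hb : IsBridgeless W inc) (hO : IsEvenFamily W inc O)
    (he : e ∈ W.biUnion inc) : HasHittingMatching W inc O e := by
  suffices H : ∀ n, SolvableBelow n V E ι from H (W.card + 1) W inc O e (by omega) h hb hO he
  intro n
  induction n with
  | zero => intro W inc O e hn; omega
  | succ n ih =>
    intro W inc O e hn h hb hO he
    have hS : SolvableBelow W.card V E ι := fun W' inc' O' e' hlt =>
      ih W' inc' O' e' (by omega)
    by_cases h4 : W.card ≤ 4
    · exact h.hasHittingMatching_of_card_le_four hO he h4
    have hev := Nat.even_iff.1 h.even_card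
    by_cases hX : ∃ X ⊆ W, (cut W inc X).card = 3 ∧ 1 < X.card ∧ 1 < (W \ X).card ∧
        e ∈ X.biUnion inc
    · obtain ⟨X, hX, hc, h1, h2, heX⟩ := hX
      have hsum := Finset.card_sdiff_of_subset hX
      have hle := Finset.card_le_card hX
      obtain ⟨z, hz⟩ := Finset.card_pos.1 (by omega : 0 < (W \ X).card)
      obtain ⟨y, hy⟩ := Finset.card_pos.1 (by omega : 0 < X.card)
      have hzX : z ∉ X := (Finset.mem_sdiff.1 hz).2
      have hyX : y ∉ W \ X := fun hh => (Finset.mem_sdiff.1 hh).2 hy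
      refine HasHittingMatching.glue h hO hX hzX hyX heX ?_ fun k hk => ?_
      · refine hS _ _ _ e ?_ (h.contract hX hc hzX) (hb.contract hX hzX) (hO.contract h hX hzX) ?_
        · rw [Finset.card_insert_of_notMem hzX]; omega
        · obtain ⟨w, hw, hew⟩ := Finset.mem_biUnion.1 heX
          refine Finset.mem_biUnion.2 ⟨w, Finset.mem_insert_of_mem hw, ?_⟩
          have hwz : w ≠ z := fun hh => hzX (hh ▸ hw)
          rwa [Function.update_of_ne hwz]
      · have hsub : W \ X ⊆ W := Finset.sdiff_subset
        refine hS _ _ _ k ?_ (h.contract hsub (by rwa [cut_compl hX]) hyX)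
          (hb.contract hsub hyX) (hO.contract h hsub hyX) ?_
        · rw [Finset.card_insert_of_notMem hyX]; omega
        · refine Finset.mem_biUnion.2 ⟨y, Finset.mem_insert_self _ _, ?_⟩
          rwa [Function.update_self, cut_compl hX]
    · have T : IsTight W inc := by
        refine ⟨h, hb, by omega, fun X hXW hc => ?_⟩
        by_contra hn'
        apply hX
        obtain ⟨w, hw, hew⟩ := Finset.mem_biUnion.1 he
        by_cases hwX : w ∈ X
        · exact ⟨X, hXW, hc, by omega, by omega, Finset.mem_biUnion.2 ⟨w, hwX, hew⟩⟩
        · refine ⟨W \ X, Finset.sdiff_subset, by rwa [cut_compl hXW], by omega, ?_,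
            Finset.mem_biUnion.2 ⟨w, Finset.mem_sdiff.2 ⟨hw, hwX⟩, hew⟩⟩
          rw [Finset.sdiff_sdiff_eq_self hXW]; omega
      have hO' : IsEvenFamily W inc fun i => if e ∈ O i then ∅ else O i := by
        refine ⟨fun i j hij => ?_, fun i v hv => ?_, fun i => ?_⟩
        · refine (hO.disj i j hij).mono ?_ ?_ <;> split_ifs <;> simp
        · split_ifs
          · simp
          · exact hO.even i v hv
        · split_ifs
          · simp
          · exact hO.subset i
      obtain ⟨M, hM, heM, hMO⟩ := T.hasHittingMatching hS hO' (e := e)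
        (fun i => by split_ifs with hh <;> simp [hh]) he
      refine ⟨M, hM, heM, fun i hi => ?_⟩
      by_cases hei : e ∈ O i
      · exact ⟨e, Finset.mem_inter.2 ⟨heM, hei⟩⟩
      · have := hMO i
        simp only [if_neg hei] at this
        exact this hi

end CubicTheorem

section Gadget

variable {V E ι : Type*} {t : ℕ}

/-- The vertices of the cubic graph replacing a graph on `V`. -/
inductive GadgetNode (V E ι : Type*) (t : ℕ)
  | top (v : V) (a : E ⊕ ι × Fin 3)
  | bot (v : V) (a : E ⊕ ι × Fin 3)
  | pair (v : V) (i : ι)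
  | hub (v : V) (i : ι)
  | core (v : V) (r : Fin t)

/-- The edges of the cubic graph replacing a graph with edge set `E`. -/
inductive GadgetEdge (V E ι : Type*) (t : ℕ)
  | orig (x : E)
  | link (v : V) (i : ι)
  | rung (v : V) (a : E ⊕ ι × Fin 3)
  | rail (v : V) (a : E ⊕ ι × Fin 3)
  | hubSpoke (v : V) (i : ι) (k : Fin 3)
  | coreSpoke (v : V) (r : Fin t) (k : Fin 3)

noncomputable instance : DecidableEq (GadgetNode V E ι t) := Classical.decEq _

noncomputable instance : DecidableEq (GadgetEdge V E ι t) := Classical.decEq _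

open GadgetNode GadgetEdge

/-- The edge at a top node leaving the ladder. -/
def topThird (v : V) : E ⊕ ι × Fin 3 → GadgetEdge V E ι t
  | .inl x => orig x
  | .inr (i, k) => hubSpoke v i k

/-- The edge at a bottom node leaving the ladder. -/
def botThird (v : V) : ι ⊕ Fin t × Fin 3 → GadgetEdge V E ι t
  | .inl i => link v i
  | .inr (r, k) => coreSpoke v r k

variable [Fintype V] [DecidableEq V] [DecidableEq E] [Fintype ι] [DecidableEq ι]

/-- The members of the family passing through `v`. -/
def touching (incG : V → Finset E) (O : ι → Finset E) (v : V) : Finset ι :=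
  Finset.univ.filter fun i => (O i ∩ incG v).Nonempty

/-- The edges at `v` in no member of the family. -/
def singles (incG : V → Finset E) (O : ι → Finset E) (v : V) : Finset E :=
  (incG v).filter fun x => ∀ i, x ∉ O i

/-- The positions on the ladder at `v`. -/
def slots (incG : V → Finset E) (O : ι → Finset E) (v : V) : Finset (E ⊕ ι × Fin 3) :=
  (singles incG O v).disjSum (touching incG O v ×ˢ Finset.univ)

/-- The edges leaving the ladder at `v` from below. -/
def sockets (t : ℕ) (incG : V → Finset E) (O : ι → Finset E) (v : V) :
    Finset (ι ⊕ Fin t × Fin 3) :=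
  (touching incG O v).disjSum Finset.univ

/-- The vertex set of the cubic graph. -/
noncomputable def gadgetVerts (t : ℕ) (incG : V → Finset E) (O : ι → Finset E) :
    Finset (GadgetNode V E ι t) :=
  Finset.univ.biUnion fun v => (slots incG O v).image (top v) ∪ (slots incG O v).image (bot v) ∪
    (touching incG O v).image (pair v) ∪ (touching incG O v).image (hub v) ∪
      Finset.univ.image (core v)

/-- The incidence function of the cubic graph. -/
noncomputable def gadgetInc (incG : V → Finset E) (O : ι → Finset E)
    (σ : V → E ⊕ ι × Fin 3 → ι ⊕ Fin t × Fin 3) (ρ : V → Equiv.Perm (E ⊕ ι × Fin 3)) :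
    GadgetNode V E ι t → Finset (GadgetEdge V E ι t)
  | top v a => {rung v a, rail v ((ρ v).symm a), topThird v a}
  | bot v a => {rung v a, rail v a, botThird v (σ v a)}
  | pair v i => insert (link v i) ((O i ∩ incG v).image orig)
  | hub v i => Finset.univ.image (hubSpoke v i)
  | core v r => Finset.univ.image (coreSpoke v r)

/-- A family of edge-disjoint cycles in a `3t`-regular graph, described through incidences. -/
structure IsCycleSystem (t : ℕ) (incG : V → Finset E) (O : ι → Finset E) : Prop where
  ends : ∀ x, ∃ p q, p ≠ q ∧ ∀ w, x ∈ incG w ↔ w = p ∨ w = q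
  card_inc : ∀ v, (incG v).card = 3 * t
  disj : ∀ i j, i ≠ j → Disjoint (O i) (O j)
  two : ∀ i v, (O i ∩ incG v).Nonempty → (O i ∩ incG v).card = 2
  conn_cycle : ∀ i (P : V → Prop),
    (∀ x ∈ O i, ∀ p q, x ∈ incG p → x ∈ incG q → P p → P q) →
      ∀ p q, (O i ∩ incG p).Nonempty → (O i ∩ incG q).Nonempty → P p → P q
  conn : ∀ v (P : V → Prop),
    (∀ x, x ∉ incG v → ∀ p q, x ∈ incG p → x ∈ incG q → P p → P q) →
      ∀ p q, p ≠ v → q ≠ v → P p → P q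

/-- The auxiliary bijections used in the cubic graph. -/
structure IsLadder (t : ℕ) (incG : V → Finset E) (O : ι → Finset E)
    (σ : V → E ⊕ ι × Fin 3 → ι ⊕ Fin t × Fin 3) (ρ : V → Equiv.Perm (E ⊕ ι × Fin 3)) : Prop where
  bij : ∀ v, Set.BijOn (σ v) (slots incG O v) (sockets t incG O v)
  cycle : ∀ v, (ρ v).IsCycleOn (slots incG O v)

variable {incG : V → Finset E} {O : ι → Finset E}
variable {σ : V → E ⊕ ι × Fin 3 → ι ⊕ Fin t × Fin 3} {ρ : V → Equiv.Perm (E ⊕ ι × Fin 3)}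

theorem mem_touching {v : V} {i : ι} : i ∈ touching incG O v ↔ (O i ∩ incG v).Nonempty := by
  simp [touching]

theorem mem_singles {v : V} {x : E} : x ∈ singles incG O v ↔ x ∈ incG v ∧ ∀ i, x ∉ O i := by
  simp [singles]

theorem inl_mem_slots {v : V} {x : E} :
    Sum.inl x ∈ slots incG O v ↔ x ∈ incG v ∧ ∀ i, x ∉ O i := by
  simp [slots, mem_singles]

theorem inr_mem_slots {v : V} {i : ι} {k : Fin 3} :
    Sum.inr (i, k) ∈ slots incG O v ↔ (O i ∩ incG v).Nonempty := by
  simp [slots, mem_touching]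

theorem inl_mem_sockets {v : V} {i : ι} :
    Sum.inl i ∈ sockets t incG O v ↔ (O i ∩ incG v).Nonempty := by
  simp [sockets, mem_touching]

theorem inr_mem_sockets {v : V} {r : Fin t × Fin 3} :
    Sum.inr r ∈ sockets t incG O v := by
  simp [sockets]

theorem top_mem {v : V} {a : E ⊕ ι × Fin 3} :
    top v a ∈ gadgetVerts t incG O ↔ a ∈ slots incG O v := by
  simp [gadgetVerts]

theorem bot_mem {v : V} {a : E ⊕ ι × Fin 3} :
    bot v a ∈ gadgetVerts t incG O ↔ a ∈ slots incG O v := by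
  simp [gadgetVerts]

theorem pair_mem {v : V} {i : ι} :
    pair v i ∈ gadgetVerts t incG O ↔ (O i ∩ incG v).Nonempty := by
  simp [gadgetVerts, mem_touching]

theorem hub_mem {v : V} {i : ι} :
    hub v i ∈ gadgetVerts t incG O ↔ (O i ∩ incG v).Nonempty := by
  simp [gadgetVerts, mem_touching]

theorem core_mem {v : V} {r : Fin t} : core v r ∈ gadgetVerts t incG O := by
  simp [gadgetVerts]

theorem card_singles (S : IsCycleSystem t incG O) (v : V) (F : Finset E) :
    (F ∩ incG v).card = (F ∩ singles incG O v).card +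
      ∑ i ∈ touching incG O v, (F ∩ (O i ∩ incG v)).card := by
  have h1 : F ∩ incG v = (F ∩ singles incG O v) ∪
      (touching incG O v).biUnion fun i => F ∩ (O i ∩ incG v) := by
    ext x
    simp only [Finset.mem_inter, Finset.mem_union, Finset.mem_biUnion, mem_singles, mem_touching]
    constructor
    · rintro ⟨hF, hx⟩
      by_cases h : ∃ i, x ∈ O i
      · obtain ⟨i, hi⟩ := h
        exact Or.inr ⟨i, ⟨x, Finset.mem_inter.2 ⟨hi, hx⟩⟩, hF, hi, hx⟩
      · push Not at h
        exact Or.inl ⟨hF, hx, h⟩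
    · rintro (⟨hF, hx, -⟩ | ⟨i, -, hF, -, hx⟩) <;> exact ⟨hF, hx⟩
  rw [h1, Finset.card_union_of_disjoint, Finset.card_biUnion]
  · intro i _ j _ hij
    exact (S.disj i j hij).mono (Finset.inter_subset_right.trans Finset.inter_subset_left)
      (Finset.inter_subset_right.trans Finset.inter_subset_left)
  · rw [Finset.disjoint_left]
    intro x hx hx'
    simp only [Finset.mem_inter, Finset.mem_biUnion, mem_singles] at hx hx'
    obtain ⟨i, -, -, hi, -⟩ := hx'
    exact hx.2.2 i hi

theorem card_slots (S : IsCycleSystem t incG O) (v : V) :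
    (slots incG O v).card = (sockets t incG O v).card := by
  have h1 := card_singles S v (incG v)
  rw [Finset.inter_self, S.card_inc] at h1
  have h2 : incG v ∩ singles incG O v = singles incG O v :=
    Finset.inter_eq_right.2 (Finset.filter_subset _ _)
  have h3 : ∑ i ∈ touching incG O v, (incG v ∩ (O i ∩ incG v)).card =
      (touching incG O v).card * 2 := by
    rw [Finset.sum_congr rfl (g := fun _ => 2), Finset.sum_const, smul_eq_mul]
    intro i hi
    rw [Finset.inter_eq_right.2 Finset.inter_subset_right]
    exact S.two i v (mem_touching.1 hi)
  rw [h2, h3] at h1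
  simp only [slots, sockets, Finset.card_disjSum, Finset.card_product, Finset.card_univ,
    Fintype.card_prod, Fintype.card_fin]
  omega

theorem exists_isLadder [Fintype E] (ht : 1 ≤ t) (S : IsCycleSystem t incG O) :
    ∃ σ ρ, IsLadder t incG O σ ρ := by
  have hne : Nonempty (ι ⊕ Fin t × Fin 3) := ⟨.inr (⟨0, ht⟩, 0)⟩
  have h1 : ∀ v, ∃ s : E ⊕ ι × Fin 3 → ι ⊕ Fin t × Fin 3,
      Set.BijOn s (slots incG O v) (sockets t incG O v) := fun v =>
    (Finset.finite_toSet _).exists_bijOn_of_encard_eq (by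
      rw [Set.encard_coe_eq_coe_finsetCard, Set.encard_coe_eq_coe_finsetCard, card_slots S])
  have h2 : ∀ v, ∃ r : Equiv.Perm (E ⊕ ι × Fin 3), r.IsCycleOn (slots incG O v) := fun v =>
    (Finset.exists_cycleOn (slots incG O v)).imp fun _ h => h.1
  choose σ hσ using h1
  choose ρ hρ using h2
  exact ⟨σ, ρ, hσ, hρ⟩

end Gadget

section GadgetEnds

variable {V E : Type*} [DecidableEq V] [DecidableEq E]

/-- The edge `f` joins the two distinct vertices `p` and `q`. -/
def Joins (W : Finset V) (inc : V → Finset E) (f : E) (p q : V) : Prop :=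
  p ∈ W ∧ q ∈ W ∧ p ≠ q ∧ ∀ w ∈ W, f ∈ inc w ↔ w = p ∨ w = q

variable {W : Finset V} {inc : V → Finset E} {f : E} {p q : V}

theorem isCubic_of_joins (h3 : ∀ v ∈ W, (inc v).card = 3)
    (h : ∀ v ∈ W, ∀ f ∈ inc v, ∃ p q, Joins W inc f p q) : IsCubic W inc := by
  refine ⟨h3, fun v hv f hf => ?_⟩
  obtain ⟨p, q, hp, hq, hpq, hw⟩ := h v hv f hf
  rcases (hw v hv).1 hf with rfl | rfl
  · exact ⟨q, hq, hpq.symm, (hw q hq).2 (Or.inr rfl), fun x hx hfx => (hw x hx).1 hfx⟩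
  · exact ⟨p, hp, hpq, (hw p hp).2 (Or.inl rfl), fun x hx hfx => ((hw x hx).1 hfx).symm⟩

theorem Joins.mem_cut (h : Joins W inc f p q) {X : Finset V} (hX : X ⊆ W) :
    f ∈ cut W inc X ↔ ¬ (p ∈ X ↔ q ∈ X) :=
  mem_cut_of_ends hX h.1 h.2.1 ((h.2.2.2 p h.1).2 (Or.inl rfl)) ((h.2.2.2 q h.2.1).2 (Or.inr rfl))
    fun x hx hf => (h.2.2.2 x hx).1 hf

end GadgetEnds

section GadgetCubic

variable {V E ι : Type*} {t : ℕ}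
variable [Fintype V] [DecidableEq V] [DecidableEq E] [Fintype ι] [DecidableEq ι]
variable {incG : V → Finset E} {O : ι → Finset E}
variable {σ : V → E ⊕ ι × Fin 3 → ι ⊕ Fin t × Fin 3} {ρ : V → Equiv.Perm (E ⊕ ι × Fin 3)}

open GadgetNode GadgetEdge

theorem topThird_eq_orig {v : V} {a : E ⊕ ι × Fin 3} {x : E} :
    (orig x : GadgetEdge V E ι t) = topThird v a ↔ a = Sum.inl x := by
  rcases a with y | ⟨i, k⟩ <;> simp [topThird, eq_comm]

theorem topThird_eq_hubSpoke {v v' : V} {a : E ⊕ ι × Fin 3} {i : ι} {k : Fin 3} :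
    (hubSpoke v i k : GadgetEdge V E ι t) = topThird v' a ↔ v' = v ∧ a = Sum.inr (i, k) := by
  rcases a with y | ⟨i, k⟩ <;> simp [topThird, eq_comm]

theorem topThird_ne {v' : V} {a : E ⊕ ι × Fin 3} :
    (∀ v b, (rung v b : GadgetEdge V E ι t) ≠ topThird v' a) ∧
    (∀ v b, (rail v b : GadgetEdge V E ι t) ≠ topThird v' a) ∧
    (∀ v i, (link v i : GadgetEdge V E ι t) ≠ topThird v' a) ∧
    (∀ v r k, (coreSpoke v r k : GadgetEdge V E ι t) ≠ topThird v' a) := by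
  rcases a with y | ⟨i, k⟩ <;> simp [topThird]

theorem botThird_eq_link {v v' : V} {b : ι ⊕ Fin t × Fin 3} {i : ι} :
    (link v i : GadgetEdge V E ι t) = botThird v' b ↔ v' = v ∧ b = Sum.inl i := by
  rcases b with j | ⟨r, k⟩ <;> simp [botThird, eq_comm]

theorem botThird_eq_coreSpoke {v v' : V} {b : ι ⊕ Fin t × Fin 3} {r : Fin t} {k : Fin 3} :
    (coreSpoke v r k : GadgetEdge V E ι t) = botThird v' b ↔ v' = v ∧ b = Sum.inr (r, k) := by
  rcases b with j | ⟨r, k⟩ <;> simp [botThird, eq_comm]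

theorem botThird_ne {v' : V} {b : ι ⊕ Fin t × Fin 3} :
    (∀ v a, (rung v a : GadgetEdge V E ι t) ≠ botThird v' b) ∧
    (∀ v a, (rail v a : GadgetEdge V E ι t) ≠ botThird v' b) ∧
    (∀ x, (orig x : GadgetEdge V E ι t) ≠ botThird v' b) ∧
    (∀ v i k, (hubSpoke v i k : GadgetEdge V E ι t) ≠ botThird v' b) := by
  rcases b with j | ⟨r, k⟩ <;> simp [botThird]

theorem IsLadder.perm_mem (L : IsLadder t incG O σ ρ) {v : V} {a : E ⊕ ι × Fin 3} :
    ρ v a ∈ slots incG O v ↔ a ∈ slots incG O v := (L.cycle v).apply_mem_iff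

theorem joins_rung {v : V} {a : E ⊕ ι × Fin 3} (ha : a ∈ slots incG O v) :
    Joins (gadgetVerts t incG O) (gadgetInc incG O σ ρ) (rung v a) (top v a) (bot v a) := by
  refine ⟨top_mem.2 ha, bot_mem.2 ha, by simp, fun w hw => ?_⟩
  cases w <;> simp [gadgetInc, topThird_ne, botThird_ne] <;> grind

theorem IsLadder.joins_rail (L : IsLadder t incG O σ ρ) {v : V} {a : E ⊕ ι × Fin 3}
    (ha : a ∈ slots incG O v) :
    Joins (gadgetVerts t incG O) (gadgetInc incG O σ ρ) (rail v a) (top v (ρ v a)) (bot v a) := by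
  refine ⟨top_mem.2 (L.perm_mem.2 ha), bot_mem.2 ha, by simp, fun w hw => ?_⟩
  cases w <;> simp [gadgetInc, topThird_ne, botThird_ne, Equiv.eq_symm_apply] <;> grind

theorem joins_orig_of_forall_notMem {x : E} {p q : V} (hpq : p ≠ q)
    (hx : ∀ w, x ∈ incG w ↔ w = p ∨ w = q) (h : ∀ i, x ∉ O i) :
    Joins (gadgetVerts t incG O) (gadgetInc incG O σ ρ) (orig x)
      (top p (Sum.inl x)) (top q (Sum.inl x)) := by
  refine ⟨top_mem.2 (inl_mem_slots.2 ⟨(hx p).2 (Or.inl rfl), h⟩),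
    top_mem.2 (inl_mem_slots.2 ⟨(hx q).2 (Or.inr rfl), h⟩), by simpa using hpq, fun w hw => ?_⟩
  cases w with
  | top v a =>
    rw [top_mem] at hw
    simp only [gadgetInc, Finset.mem_insert, Finset.mem_singleton, reduceCtorEq, false_or,
      topThird_eq_orig, top.injEq]
    constructor
    · rintro rfl
      simpa using (hx v).1 (inl_mem_slots.1 hw).1
    · tauto
  | _ => simp [gadgetInc, botThird_ne, h]

theorem IsCycleSystem.joins_orig_of_mem (S : IsCycleSystem t incG O) {x : E} {p q : V} (hpq : p ≠ q)
    (hx : ∀ w, x ∈ incG w ↔ w = p ∨ w = q) {i : ι} (h : x ∈ O i) :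
    Joins (gadgetVerts t incG O) (gadgetInc incG O σ ρ) (orig x) (pair p i) (pair q i) := by
  refine ⟨pair_mem.2 ⟨x, Finset.mem_inter.2 ⟨h, (hx p).2 (Or.inl rfl)⟩⟩,
    pair_mem.2 ⟨x, Finset.mem_inter.2 ⟨h, (hx q).2 (Or.inr rfl)⟩⟩, by simpa using hpq,
    fun w hw => ?_⟩
  cases w with
  | top v a =>
    rw [top_mem] at hw
    simp only [gadgetInc, Finset.mem_insert, Finset.mem_singleton, reduceCtorEq, false_or,
      topThird_eq_orig, or_false, iff_false]
    rintro rfl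
    exact (inl_mem_slots.1 hw).2 i h
  | pair v j =>
    have hj : x ∈ O j ↔ j = i := by
      constructor
      · intro hj
        by_contra hij
        exact Finset.disjoint_left.1 (S.disj j i hij) hj h
      · rintro rfl
        exact h
    simp [gadgetInc, hx, hj]
    tauto
  | _ => simp [gadgetInc, botThird_ne]

theorem IsLadder.joins_link (L : IsLadder t incG O σ ρ) {v : V} {i : ι} {b : E ⊕ ι × Fin 3}
    (hb : b ∈ slots incG O v) (hi : σ v b = Sum.inl i) :
    Joins (gadgetVerts t incG O) (gadgetInc incG O σ ρ) (link v i) (pair v i) (bot v b) := by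
  have h1 := (L.bij v).mapsTo hb
  rw [hi, Finset.mem_coe, inl_mem_sockets] at h1
  refine ⟨pair_mem.2 h1, bot_mem.2 hb, by simp, fun w hw => ?_⟩
  cases w with
  | bot v' a =>
    rw [bot_mem] at hw
    simp only [gadgetInc, Finset.mem_insert, Finset.mem_singleton, reduceCtorEq, false_or,
      botThird_eq_link, bot.injEq]
    refine and_congr_right fun hv => ?_
    subst hv
    exact ⟨fun h => (L.bij v').injOn hw hb (h.trans hi.symm), fun h => h ▸ hi⟩
  | pair v' j => simp [gadgetInc, eq_comm]
  | _ => simp [gadgetInc, topThird_ne]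

theorem IsLadder.joins_coreSpoke (L : IsLadder t incG O σ ρ) {v : V} {r : Fin t} {k : Fin 3}
    {b : E ⊕ ι × Fin 3} (hb : b ∈ slots incG O v) (hi : σ v b = Sum.inr (r, k)) :
    Joins (gadgetVerts t incG O) (gadgetInc incG O σ ρ) (coreSpoke v r k) (core v r) (bot v b) := by
  refine ⟨core_mem, bot_mem.2 hb, by simp, fun w hw => ?_⟩
  cases w with
  | bot v' a =>
    rw [bot_mem] at hw
    simp only [gadgetInc, Finset.mem_insert, Finset.mem_singleton, reduceCtorEq, false_or,
      botThird_eq_coreSpoke, bot.injEq]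
    refine and_congr_right fun hv => ?_
    subst hv
    exact ⟨fun h => (L.bij v').injOn hw hb (h.trans hi.symm), fun h => h ▸ hi⟩
  | _ => simp [gadgetInc, topThird_ne]

theorem joins_hubSpoke {v : V} {i : ι} {k : Fin 3} (h : (O i ∩ incG v).Nonempty) :
    Joins (gadgetVerts t incG O) (gadgetInc incG O σ ρ) (hubSpoke v i k)
      (hub v i) (top v (Sum.inr (i, k))) := by
  refine ⟨hub_mem.2 h, top_mem.2 (inr_mem_slots.2 h), by simp, fun w hw => ?_⟩
  cases w <;> simp [gadgetInc, topThird_eq_hubSpoke, botThird_ne]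

theorem IsLadder.isCubic (S : IsCycleSystem t incG O) (L : IsLadder t incG O σ ρ) :
    IsCubic (gadgetVerts t incG O) (gadgetInc incG O σ ρ) := by
  have hO : ∀ x, ∃ p q, Joins (gadgetVerts t incG O) (gadgetInc incG O σ ρ) (orig x) p q := by
    intro x
    obtain ⟨p, q, hpq, hx⟩ := S.ends x
    by_cases h : ∃ i, x ∈ O i
    · obtain ⟨i, hi⟩ := h
      exact ⟨_, _, S.joins_orig_of_mem hpq hx hi⟩
    · push Not at h
      exact ⟨_, _, joins_orig_of_forall_notMem hpq hx h⟩
  refine isCubic_of_joins (fun w hw => ?_) fun w hw f hf => ?_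
  · cases w with
    | top v a =>
      rw [gadgetInc, Finset.card_eq_three]
      exact ⟨_, _, _, by simp, topThird_ne.1 _ _, topThird_ne.2.1 _ _, rfl⟩
    | bot v a =>
      rw [gadgetInc, Finset.card_eq_three]
      exact ⟨_, _, _, by simp, botThird_ne.1 _ _, botThird_ne.2.1 _ _, rfl⟩
    | pair v i =>
      rw [gadgetInc, Finset.card_insert_of_notMem (by simp),
        Finset.card_image_of_injective _ fun _ _ h => by simpa using h,
        S.two i v (pair_mem.1 hw)]
    | hub v i =>
      rw [gadgetInc, Finset.card_image_of_injective _ fun _ _ h => by simpa using h]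
      rfl
    | core v r =>
      rw [gadgetInc, Finset.card_image_of_injective _ fun _ _ h => by simpa using h]
      rfl
  · cases w with
    | top v a =>
      rw [top_mem] at hw
      simp only [gadgetInc, Finset.mem_insert, Finset.mem_singleton] at hf
      rcases hf with rfl | rfl | rfl
      · exact ⟨_, _, joins_rung hw⟩
      · exact ⟨_, _, L.joins_rail (L.perm_mem.1 (by simpa using hw))⟩
      · rcases a with x | ⟨i, k⟩
        · exact hO x
        · exact ⟨_, _, joins_hubSpoke (inr_mem_slots.1 hw)⟩
    | bot v a =>
      rw [bot_mem] at hw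
      simp only [gadgetInc, Finset.mem_insert, Finset.mem_singleton] at hf
      rcases hf with rfl | rfl | rfl
      · exact ⟨_, _, joins_rung hw⟩
      · exact ⟨_, _, L.joins_rail hw⟩
      · rcases h : σ v a with i | ⟨r, k⟩
        · exact ⟨_, _, L.joins_link hw h⟩
        · exact ⟨_, _, L.joins_coreSpoke hw h⟩
    | pair v i =>
      simp only [gadgetInc, Finset.mem_insert, Finset.mem_image] at hf
      rcases hf with rfl | ⟨x, -, rfl⟩
      · obtain ⟨b, hb, hi⟩ := (L.bij v).surjOn (inl_mem_sockets.2 (pair_mem.1 hw))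
        exact ⟨_, _, L.joins_link hb hi⟩
      · exact hO x
    | hub v i =>
      simp only [gadgetInc, Finset.mem_image] at hf
      obtain ⟨k, -, rfl⟩ := hf
      exact ⟨_, _, joins_hubSpoke (hub_mem.1 hw)⟩
    | core v r =>
      simp only [gadgetInc, Finset.mem_image] at hf
      obtain ⟨k, -, rfl⟩ := hf
      obtain ⟨b, hb, hi⟩ := (L.bij v).surjOn (inr_mem_sockets (r := (r, k)))
      exact ⟨_, _, L.joins_coreSpoke hb hi⟩

theorem IsCycleSystem.isEvenFamily (S : IsCycleSystem t incG O) :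
    IsEvenFamily (gadgetVerts t incG O) (gadgetInc incG O σ ρ) fun i => (O i).image orig := by
  have hsub : ∀ i, (O i).image (orig : E → GadgetEdge V E ι t) ⊆
      (gadgetVerts t incG O).biUnion (gadgetInc incG O σ ρ) := by
    intro i f hf
    obtain ⟨x, hx, rfl⟩ := Finset.mem_image.1 hf
    obtain ⟨p, q, hpq, hends⟩ := S.ends x
    have hJ := S.joins_orig_of_mem (σ := σ) (ρ := ρ) (t := t) hpq hends hx
    exact Finset.mem_biUnion.2 ⟨_, hJ.1, (hJ.2.2.2 _ hJ.1).2 (Or.inl rfl)⟩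
  refine ⟨fun i j hij => ?_, fun i w hw => ?_, hsub⟩
  · rw [Finset.disjoint_image fun _ _ h => by simpa using h]
    exact S.disj i j hij
  have hzero : ∀ w : GadgetNode V E ι t, (∀ x ∈ O i, orig x ∉ gadgetInc incG O σ ρ w) →
      Even ((O i).image orig ∩ gadgetInc incG O σ ρ w).card := by
    intro w hw
    rw [Finset.disjoint_iff_inter_eq_empty.1, Finset.card_empty]
    · exact Even.zero
    · rw [Finset.disjoint_left]
      intro f hf
      obtain ⟨x, hx, rfl⟩ := Finset.mem_image.1 hf
      exact hw x hx
  cases w with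
  | top v a =>
    refine hzero _ fun x hx h => ?_
    simp only [gadgetInc, Finset.mem_insert, Finset.mem_singleton, reduceCtorEq, false_or,
      topThird_eq_orig] at h
    subst h
    exact (inl_mem_slots.1 (top_mem.1 hw)).2 i hx
  | pair v j =>
    by_cases hij : j = i
    · subst hij
      have h1 : (O j).image (orig : E → GadgetEdge V E ι t) ∩ gadgetInc incG O σ ρ (pair v j) =
          (O j ∩ incG v).image orig := by
        ext f
        simp only [gadgetInc, Finset.mem_inter, Finset.mem_insert, Finset.mem_image]
        grind
      rw [h1, Finset.card_image_of_injective _ fun _ _ h => by simpa using h,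
        S.two j v (pair_mem.1 hw)]
      exact even_two
    · refine hzero _ fun x hx h => ?_
      simp only [gadgetInc, Finset.mem_insert, Finset.mem_image, reduceCtorEq, false_or,
        orig.injEq, exists_eq_right, Finset.mem_inter] at h
      exact Finset.disjoint_left.1 (S.disj j i hij) h.1 hx
  | _ => exact hzero _ fun x _ => by simp [gadgetInc, botThird_ne]

end GadgetCubic

section GadgetBridgeless

variable {V E ι : Type*} {t : ℕ}
variable [Fintype V] [DecidableEq V] [DecidableEq E] [Fintype ι] [DecidableEq ι]
variable {incG : V → Finset E} {O : ι → Finset E}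
variable {σ : V → E ⊕ ι × Fin 3 → ι ⊕ Fin t × Fin 3} {ρ : V → Equiv.Perm (E ⊕ ι × Fin 3)}
variable {X : Finset (GadgetNode V E ι t)}

open GadgetNode GadgetEdge

theorem IsCubic.inter_cut_eq_empty {V E : Type*} [DecidableEq V] [DecidableEq E]
    {W : Finset V} {inc : V → Finset E} (h : IsCubic W inc) {X : Finset V} (hX : X ⊆ W)
    (hc : (cut W inc X).card = 1) {R : Finset E} (hR : ∀ v ∈ X, Even (R ∩ inc v).card) :
    R ∩ cut W inc X = ∅ := by
  have h1 := h.even_cut hX hR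
  have h2 := (Finset.card_le_card (Finset.inter_subset_right (s₁ := R))).trans hc.le
  rw [← Finset.card_eq_zero]
  rcases h1 with ⟨k, hk⟩
  omega

theorem IsLadder.exists_side (S : IsCycleSystem t incG O) (L : IsLadder t incG O σ ρ)
    (hX : X ⊆ gadgetVerts t incG O)
    (hc : (cut (gadgetVerts t incG O) (gadgetInc incG O σ ρ) X).card = 1) :
    ∃ s : V → Prop, ∀ v, ∀ a ∈ slots incG O v, (top v a ∈ X ↔ s v) ∧ (bot v a ∈ X ↔ s v) := by
  have hC := L.isCubic S
  have hR : ∀ v, ((slots incG O v).image (rung v) ∪ (slots incG O v).image (rail v)) ∩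
      cut (gadgetVerts t incG O) (gadgetInc incG O σ ρ) X = ∅ := by
    intro v
    refine hC.inter_cut_eq_empty hX hc fun w hw => ?_
    replace hw := hX hw
    have key : ∀ a b, a ∈ slots incG O v → b ∈ slots incG O v →
        ∀ f : GadgetEdge V E ι t, (∀ c, rung v c ≠ f) → (∀ c, rail v c ≠ f) →
        Even (((slots incG O v).image (rung v) ∪ (slots incG O v).image (rail v)) ∩
          {rung v a, rail v b, f}).card := by
      intro a b ha hb f hf1 hf2
      have : ((slots incG O v).image (rung v) ∪ (slots incG O v).image (rail v)) ∩
          {rung v a, rail v b, f} = {rung v a, rail v b} := by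
        ext g
        simp only [Finset.mem_inter, Finset.mem_union, Finset.mem_image, Finset.mem_insert,
          Finset.mem_singleton]
        grind
      rw [this, Finset.card_pair (by simp)]
      exact even_two
    have zero : (∀ a, rung v a ∉ gadgetInc incG O σ ρ w) →
        (∀ a, rail v a ∉ gadgetInc incG O σ ρ w) →
        Even (((slots incG O v).image (rung v) ∪ (slots incG O v).image (rail v)) ∩
          gadgetInc incG O σ ρ w).card := by
      intro h1 h2
      rw [Finset.disjoint_iff_inter_eq_empty.1, Finset.card_empty]
      · exact Even.zero
      · rw [Finset.disjoint_left]
        intro f hf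
        simp only [Finset.mem_union, Finset.mem_image] at hf
        rcases hf with ⟨a, -, rfl⟩ | ⟨a, -, rfl⟩
        · exact h1 a
        · exact h2 a
    cases w with
    | top v' a =>
      by_cases hv : v' = v
      · subst hv
        rw [top_mem] at hw
        exact key _ _ hw (L.perm_mem.1 (by simpa using hw)) _ (topThird_ne.1 _)
          (topThird_ne.2.1 _)
      · exact zero (fun b => by simp [gadgetInc, topThird_ne, Ne.symm hv])
          fun b => by simp [gadgetInc, topThird_ne, Ne.symm hv]
    | bot v' a =>
      by_cases hv : v' = v
      · subst hv
        rw [bot_mem] at hw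
        exact key _ _ hw hw _ (botThird_ne.1 _) (botThird_ne.2.1 _)
      · exact zero (fun b => by simp [gadgetInc, botThird_ne, Ne.symm hv])
          fun b => by simp [gadgetInc, botThird_ne, Ne.symm hv]
    | _ => exact zero (fun b => by simp [gadgetInc]) fun b => by simp [gadgetInc]
  have h1 : ∀ v, ∀ a ∈ slots incG O v, (top v a ∈ X ↔ bot v a ∈ X) := by
    intro v a ha
    by_contra h
    rw [← (joins_rung (σ := σ) (ρ := ρ) ha).mem_cut hX] at h
    exact Finset.eq_empty_iff_forall_notMem.1 (hR v) _ (Finset.mem_inter.2 ⟨Finset.mem_union_left _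
      (Finset.mem_image_of_mem _ ha), h⟩)
  have h2 : ∀ v, ∀ a ∈ slots incG O v, (top v (ρ v a) ∈ X ↔ bot v a ∈ X) := by
    intro v a ha
    by_contra h
    rw [← (L.joins_rail ha).mem_cut hX] at h
    exact Finset.eq_empty_iff_forall_notMem.1 (hR v) _ (Finset.mem_inter.2 ⟨Finset.mem_union_right _
      (Finset.mem_image_of_mem _ ha), h⟩)
  have h3 : ∀ v, ∀ a ∈ slots incG O v, ∀ n : ℕ,
      ((ρ v ^ n) a ∈ slots incG O v ∧ (top v ((ρ v ^ n) a) ∈ X ↔ top v a ∈ X)) := by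
    intro v a ha n
    induction n with
    | zero => simpa using ha
    | succ n ih =>
      rw [pow_succ', Equiv.Perm.mul_apply, L.perm_mem, h2 v _ ih.1, ← h1 v _ ih.1]
      exact ih
  have h4 : ∀ v, ∀ a ∈ slots incG O v, (top v a ∈ X ↔ ∃ b ∈ slots incG O v, top v b ∈ X) := by
    intro v a ha
    refine ⟨fun h => ⟨a, ha, h⟩, ?_⟩
    rintro ⟨b, hb, h⟩
    obtain ⟨n, -, rfl⟩ := (L.cycle v).exists_pow_eq ha hb
    exact (h3 v a ha n).2.1 h
  exact ⟨_, fun v a ha => ⟨h4 v a ha, (h1 v a ha).symm.trans (h4 v a ha)⟩⟩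

theorem IsLadder.isBridgeless (ht : 1 ≤ t) (S : IsCycleSystem t incG O)
    (L : IsLadder t incG O σ ρ) :
    IsBridgeless (gadgetVerts t incG O) (gadgetInc incG O σ ρ) := by
  intro X hX hc
  have hC := L.isCubic S
  obtain ⟨s, hs⟩ := L.exists_side S hX hc
  have hO : ∀ i, ∀ x ∈ O i, orig x ∉ cut (gadgetVerts t incG O) (gadgetInc incG O σ ρ) X :=
    fun i x hx h => Finset.eq_empty_iff_forall_notMem.1 (hC.inter_cut_eq_empty hX hc
      fun w hw => (S.isEvenFamily (σ := σ) (ρ := ρ)).even i w (hX hw)) _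
        (Finset.mem_inter.2 ⟨Finset.mem_image_of_mem _ hx, h⟩)
  obtain ⟨f, hf⟩ := Finset.card_eq_one.1 hc
  have hff : f ∈ cut (gadgetVerts t incG O) (gadgetInc incG O σ ρ) X := by simp [hf]
  have huncut : ∀ g p q, Joins (gadgetVerts t incG O) (gadgetInc incG O σ ρ) g p q → g ≠ f →
      (p ∈ X ↔ q ∈ X) := by
    intro g p q hg hgf
    by_contra h
    rw [← hg.mem_cut hX, hf, Finset.mem_singleton] at h
    exact hgf h
  have hpair : ∀ i p q, (O i ∩ incG p).Nonempty → (O i ∩ incG q).Nonempty →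
      (pair p i ∈ X → pair q i ∈ X) := by
    intro i
    refine S.conn_cycle i _ ?_
    intro x hx p q hp hq h
    obtain ⟨p', q', hpq', hends⟩ := S.ends x
    have hJ := S.joins_orig_of_mem (σ := σ) (ρ := ρ) (t := t) hpq' hends hx
    have h1 := hO i x hx
    rw [hJ.mem_cut hX, not_not] at h1
    rcases (hends p).1 hp with rfl | rfl <;> rcases (hends q).1 hq with rfl | rfl
    · exact h
    · exact h1.1 h
    · exact h1.2 h
    · exact h
  have hlink : ∀ v i, (O i ∩ incG v).Nonempty → link v i ≠ f → (pair v i ∈ X ↔ s v) := by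
    intro v i h hne
    obtain ⟨b, hb, hi⟩ := (L.bij v).surjOn (inl_mem_sockets.2 h)
    exact (huncut _ _ _ (L.joins_link hb hi) hne).trans (hs v b hb).2
  have hstep : ∀ x p q, x ∈ incG p → x ∈ incG q → orig x ≠ f →
      (∀ j, x ∈ O j → link p j ≠ f ∧ link q j ≠ f) → s p → s q := by
    intro x p q hp hq hxf hlf h
    by_cases hx : ∃ i, x ∈ O i
    · obtain ⟨i, hi⟩ := hx
      have hip : (O i ∩ incG p).Nonempty := ⟨x, Finset.mem_inter.2 ⟨hi, hp⟩⟩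
      have hiq : (O i ∩ incG q).Nonempty := ⟨x, Finset.mem_inter.2 ⟨hi, hq⟩⟩
      rw [← hlink q i hiq (hlf i hi).2]
      rw [← hlink p i hip (hlf i hi).1] at h
      exact hpair i p q hip hiq h
    · push Not at hx
      by_cases hpq : p = q
      · exact hpq ▸ h
      have hends : ∀ w, x ∈ incG w ↔ w = p ∨ w = q := by
        obtain ⟨p', q', hpq', hends⟩ := S.ends x
        have h1 := (hends p).1 hp
        have h2 := (hends q).1 hq
        grind
      rw [← (hs q _ (inl_mem_slots.2 ⟨hq, hx⟩)).1]
      rw [← (hs p _ (inl_mem_slots.2 ⟨hp, hx⟩)).1] at h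
      exact (huncut _ _ _ (joins_orig_of_forall_notMem hpq hends hx) hxf).1 h
  have hother : ∀ x v, x ∈ incG v → ∃ q, q ≠ v ∧ x ∈ incG q := by
    intro x v hv
    obtain ⟨p, q, hpq, hends⟩ := S.ends x
    rcases (hends v).1 hv with rfl | rfl
    · exact ⟨q, hpq.symm, (hends q).2 (Or.inr rfl)⟩
    · exact ⟨p, hpq, (hends p).2 (Or.inl rfl)⟩
  have hfhub : ∀ v i k, (O i ∩ incG v).Nonempty → f ≠ hubSpoke v i k := by
    rintro v i k hi rfl
    have h1 := huncut (hubSpoke v i (k + 1)) _ _ (joins_hubSpoke hi) (by simp)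
    have h2 := ((joins_hubSpoke (σ := σ) (ρ := ρ) hi).mem_cut hX).1 hff
    rw [(hs v _ (inr_mem_slots.2 hi)).1] at h1 h2
    exact h2 h1
  have hfcore : ∀ v r k, f ≠ coreSpoke v r k := by
    rintro v r k rfl
    obtain ⟨b, hb, hi⟩ := (L.bij v).surjOn (inr_mem_sockets (r := (r, k)))
    obtain ⟨b', hb', hi'⟩ := (L.bij v).surjOn (inr_mem_sockets (r := (r, k + 1)))
    have h1 := huncut _ _ _ (L.joins_coreSpoke hb' hi') (by simp)
    have h2 := ((L.joins_coreSpoke hb hi).mem_cut hX).1 hff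
    rw [(hs v _ hb').2] at h1
    rw [(hs v _ hb).2] at h2
    exact h2 h1
  have hconst : ∀ v0, (∀ x ∉ incG v0, orig x ≠ f) → (∀ v j, v ≠ v0 → link v j ≠ f) →
      ∀ p q, p ≠ v0 → q ≠ v0 → s p → s q := by
    intro v0 h1 h2
    refine S.conn v0 s fun x hx p q hp hq => hstep x p q hp hq (h1 x hx) fun j _ => ?_
    exact ⟨h2 p j fun h => hx (h ▸ hp), h2 q j fun h => hx (h ▸ hq)⟩
  have hforig : ∀ x, f ≠ orig x := by
    rintro x rfl
    by_cases hx : ∃ i, x ∈ O i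
    · obtain ⟨i, hi⟩ := hx
      exact hO i x hi hff
    push Not at hx
    obtain ⟨p, q, hpq, hends⟩ := S.ends x
    have hp := (hends p).2 (Or.inl rfl)
    have hq := (hends q).2 (Or.inr rfl)
    have hcs := hconst p (fun y hy h => hy (by simp at h; exact h ▸ hp)) (by simp)
    obtain ⟨y, hy, hyx⟩ := Finset.exists_mem_ne (by rw [S.card_inc]; omega : 1 < (incG p).card) x
    obtain ⟨r, hrp, hr⟩ := hother y p hy
    have h2 := ((joins_orig_of_forall_notMem (σ := σ) (ρ := ρ) hpq hends hx).mem_cut hX).1 hff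
    rw [(hs p _ (inl_mem_slots.2 ⟨hp, hx⟩)).1, (hs q _ (inl_mem_slots.2 ⟨hq, hx⟩)).1] at h2
    have h3 := hstep y p r hy hr (by simpa using hyx) (by simp)
    have h4 := hstep y r p hr hy (by simpa using hyx) (by simp)
    have h5 := hcs r q hrp hpq.symm
    have h6 := hcs q r hpq.symm hrp
    exact h2 ⟨fun h => h5 (h3 h), fun h => h4 (h6 h)⟩
  have hflink : ∀ v i, (O i ∩ incG v).Nonempty → f ≠ link v i := by
    rintro v i hi rfl
    have hcs := hconst v (by simp) (fun w j hw => by simp [hw])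
    obtain ⟨b, hb, hbi⟩ := (L.bij v).surjOn (inl_mem_sockets.2 hi)
    have h2 := ((L.joins_link hb hbi).mem_cut hX).1 hff
    rw [(hs v _ hb).2] at h2
    obtain ⟨x, hx⟩ := id hi
    rw [Finset.mem_inter] at hx
    obtain ⟨q, hqv, hq⟩ := hother x v hx.2
    have hiq : (O i ∩ incG q).Nonempty := ⟨x, Finset.mem_inter.2 ⟨hx.1, hq⟩⟩
    have h3 := hlink q i hiq (by simp [hqv])
    have h4 := hpair i v q hi hiq
    have h5 := hpair i q v hiq hi
    obtain ⟨y, hy, hyO⟩ : ∃ y ∈ incG v, y ∉ O i ∩ incG v := by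
      refine Finset.exists_mem_notMem_of_card_lt_card ?_
      rw [S.card_inc, S.two i v hi]
      omega
    replace hyO : y ∉ O i := fun h => hyO (Finset.mem_inter.2 ⟨h, hy⟩)
    obtain ⟨r, hrv, hr⟩ := hother y v hy
    have hj : ∀ j, y ∈ O j → j ≠ i := fun j h hji => hyO (hji ▸ h)
    have h6 := hstep y v r hy hr (by simp) fun j h => by simp [hj j h]
    have h7 := hstep y r v hr hy (by simp) fun j h => by simp [hj j h]
    have h8 := hcs r q hrv hqv
    have h9 := hcs q r hqv hrv
    exact h2 ⟨fun h => h7 (h9 (h3.1 (h4 h))), fun h => h5 (h3.2 (h8 (h6 h)))⟩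
  obtain ⟨w, hw, hfw⟩ := Finset.mem_biUnion.1 (cut_subset X hff)
  replace hw := hX hw
  cases w with
  | top v a =>
    rw [top_mem] at hw
    simp only [gadgetInc, Finset.mem_insert, Finset.mem_singleton] at hfw
    rcases hfw with rfl | rfl | rfl
    · have := ((joins_rung (σ := σ) (ρ := ρ) hw).mem_cut hX).1 hff
      rw [(hs v a hw).1, (hs v a hw).2] at this
      exact this Iff.rfl
    · have ha : (ρ v).symm a ∈ slots incG O v := L.perm_mem.1 (by simpa using hw)
      have := ((L.joins_rail ha).mem_cut hX).1 hff
      rw [(hs v _ ha).2, (hs v _ (L.perm_mem.2 ha)).1] at this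
      exact this Iff.rfl
    · rcases a with x | ⟨i, k⟩
      · exact hforig x rfl
      · exact hfhub v i k (inr_mem_slots.1 hw) rfl
  | bot v a =>
    rw [bot_mem] at hw
    simp only [gadgetInc, Finset.mem_insert, Finset.mem_singleton] at hfw
    rcases hfw with rfl | rfl | rfl
    · have := ((joins_rung (σ := σ) (ρ := ρ) hw).mem_cut hX).1 hff
      rw [(hs v a hw).1, (hs v a hw).2] at this
      exact this Iff.rfl
    · have := ((L.joins_rail hw).mem_cut hX).1 hff
      rw [(hs v _ hw).2, (hs v _ (L.perm_mem.2 hw)).1] at this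
      exact this Iff.rfl
    · have h1 := (L.bij v).mapsTo hw
      rcases h : σ v a with i | ⟨r, k⟩
      · rw [h] at h1
        exact hflink v i (inl_mem_sockets.1 h1) (by rw [h]; rfl)
      · exact hfcore v r k (by rw [h]; rfl)
  | pair v i =>
    simp only [gadgetInc, Finset.mem_insert, Finset.mem_image] at hfw
    rcases hfw with rfl | ⟨x, -, rfl⟩
    · exact hflink v i (pair_mem.1 hw) rfl
    · exact hforig x rfl
  | hub v i =>
    simp only [gadgetInc, Finset.mem_image] at hfw
    obtain ⟨k, -, rfl⟩ := hfw
    exact hfhub v i k (hub_mem.1 hw) rfl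
  | core v r =>
    simp only [gadgetInc, Finset.mem_image] at hfw
    obtain ⟨k, -, rfl⟩ := hfw
    exact hfcore v r k rfl

end GadgetBridgeless

section GadgetFactor

variable {V E ι : Type*} {t : ℕ}
variable [Fintype V] [DecidableEq V] [DecidableEq E] [Fintype ι] [DecidableEq ι]
variable {incG : V → Finset E} {O : ι → Finset E}
variable {σ : V → E ⊕ ι × Fin 3 → ι ⊕ Fin t × Fin 3} {ρ : V → Equiv.Perm (E ⊕ ι × Fin 3)}

open GadgetNode GadgetEdge

theorem card_inter_eq_sum {E : Type*} [DecidableEq E] (M A : Finset E) :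
    (M ∩ A).card = ∑ f ∈ A, if f ∈ M then 1 else 0 := by
  rw [Finset.sum_boole, Finset.filter_mem_eq_inter, Finset.inter_comm]
  rfl

theorem IsPerfectMatching.card_pair {M : Finset (GadgetEdge V E ι t)}
    (hM : IsPerfectMatching (gadgetVerts t incG O) (gadgetInc incG O σ ρ) M) {F : Finset E}
    (hF : ∀ x, x ∈ F ↔ orig x ∈ M) {v : V} {i : ι} (h : (O i ∩ incG v).Nonempty) :
    (if link v i ∈ M then 1 else 0) + (F ∩ (O i ∩ incG v)).card = 1 := by
  have h1 := hM _ (pair_mem.2 h)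
  rw [card_inter_eq_sum, gadgetInc, Finset.sum_insert (by simp),
    Finset.sum_image fun _ _ _ _ h => by simpa using h] at h1
  rw [card_inter_eq_sum]
  simpa only [hF] using h1

theorem IsLadder.card_factor (S : IsCycleSystem t incG O) (L : IsLadder t incG O σ ρ)
    {M : Finset (GadgetEdge V E ι t)}
    (hM : IsPerfectMatching (gadgetVerts t incG O) (gadgetInc incG O σ ρ) M) {F : Finset E}
    (hF : ∀ x, x ∈ F ↔ orig x ∈ M) (v : V) : (F ∩ incG v).card = t := by
  let m : GadgetEdge V E ι t → ℕ := fun f => if f ∈ M then 1 else 0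
  have htop : ∀ a ∈ slots incG O v,
      m (rung v a) + m (rail v ((ρ v).symm a)) + m (topThird v a) = 1 := by
    intro a ha
    have h1 := hM _ (top_mem.2 ha)
    rw [card_inter_eq_sum, gadgetInc, Finset.sum_insert, Finset.sum_insert,
      Finset.sum_singleton, ← add_assoc] at h1
    · exact h1
    · simp [topThird_ne]
    · simp [topThird_ne]
  have hbot : ∀ a ∈ slots incG O v,
      m (rung v a) + m (rail v a) + m (botThird v (σ v a)) = 1 := by
    intro a ha
    have h1 := hM _ (bot_mem.2 ha)
    rw [card_inter_eq_sum, gadgetInc, Finset.sum_insert, Finset.sum_insert,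
      Finset.sum_singleton, ← add_assoc] at h1
    · exact h1
    · simp [botThird_ne]
    · simp [botThird_ne]
  have hrail : ∑ a ∈ slots incG O v, m (rail v ((ρ v).symm a)) =
      ∑ a ∈ slots incG O v, m (rail v a) :=
    Finset.sum_equiv (ρ v).symm (fun a => by
      rw [← L.perm_mem (a := (ρ v).symm a), Equiv.apply_symm_apply]) fun _ _ => rfl
  have hbij : ∑ a ∈ slots incG O v, m (botThird v (σ v a)) =
      ∑ b ∈ sockets t incG O v, m (botThird v b) :=
    Finset.sum_nbij (σ v) (fun a ha => (L.bij v).mapsTo ha) (L.bij v).injOn (L.bij v).surjOn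
      fun _ _ => rfl
  have hsum := (Finset.sum_congr rfl htop).trans (Finset.sum_congr rfl hbot).symm
  simp only [Finset.sum_add_distrib] at hsum
  rw [hrail, hbij, add_right_inj] at hsum
  have hhub : ∀ i ∈ touching incG O v, ∑ k : Fin 3, m (hubSpoke v i k) = 1 := by
    intro i hi
    have h1 := hM _ (hub_mem.2 (mem_touching.1 hi))
    rwa [card_inter_eq_sum, gadgetInc, Finset.sum_image fun _ _ _ _ h => by simpa using h] at h1
  have hcore : ∀ r : Fin t, ∑ k : Fin 3, m (coreSpoke v r k) = 1 := by
    intro r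
    have h1 := hM _ (core_mem (v := v) (r := r))
    rwa [card_inter_eq_sum, gadgetInc, Finset.sum_image fun _ _ _ _ h => by simpa using h] at h1
  have hpair : ∑ i ∈ touching incG O v, (m (link v i) + (F ∩ (O i ∩ incG v)).card) =
      (touching incG O v).card := by
    rw [Finset.card_eq_sum_ones]
    exact Finset.sum_congr rfl fun i hi => hM.card_pair hF (mem_touching.1 hi)
  have hT : ∑ a ∈ slots incG O v, m (topThird v a) =
      (F ∩ singles incG O v).card + (touching incG O v).card := by
    rw [slots, Finset.sum_disjSum, Finset.sum_product, card_inter_eq_sum,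
      Finset.card_eq_sum_ones (touching incG O v), ← Finset.sum_congr rfl hhub]
    simp only [hF]
    rfl
  have hB : ∑ b ∈ sockets t incG O v, m (botThird v b) =
      ∑ i ∈ touching incG O v, m (link v i) + t := by
    rw [sockets, Finset.sum_disjSum, Fintype.sum_prod_type]
    have : ∑ r : Fin t, ∑ k : Fin 3, m (botThird v (Sum.inr (r, k))) = t :=
      (Finset.sum_congr rfl fun r _ => hcore r).trans (by simp)
    rw [this]
    rfl
  rw [Finset.sum_add_distrib] at hpair
  rw [card_singles S]
  omega

/-- The conclusion for graphs described through incidences. -/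
theorem IsCycleSystem.exists_factor [Fintype E] (ht : 1 ≤ t) (S : IsCycleSystem t incG O)
    (hodd : ∀ i, Odd (O i).card) (e : E) :
    ∃ F : Finset E, (∀ v, (F ∩ incG v).card = t) ∧ e ∈ F ∧ (∀ i, (F ∩ O i).Nonempty) ∧
      ∀ i v, (F ∩ (O i ∩ incG v)).card ≤ 1 := by
  obtain ⟨σ, ρ, L⟩ := exists_isLadder ht S
  have he : (orig e : GadgetEdge V E ι t) ∈
      (gadgetVerts t incG O).biUnion (gadgetInc incG O σ ρ) := by
    obtain ⟨p, q, hpq, hends⟩ := S.ends e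
    by_cases hi : ∃ i, e ∈ O i
    · obtain ⟨i, hi⟩ := hi
      have hJ := S.joins_orig_of_mem (σ := σ) (ρ := ρ) hpq hends hi
      exact Finset.mem_biUnion.2 ⟨_, hJ.1, (hJ.2.2.2 _ hJ.1).2 (Or.inl rfl)⟩
    · push Not at hi
      have hJ := joins_orig_of_forall_notMem (σ := σ) (ρ := ρ) hpq hends hi
      exact Finset.mem_biUnion.2 ⟨_, hJ.1, (hJ.2.2.2 _ hJ.1).2 (Or.inl rfl)⟩
  obtain ⟨M, hM, heM, hMO⟩ := hasHittingMatching _ _ _ _ (L.isCubic S) (L.isBridgeless ht S)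
    S.isEvenFamily he
  have hF : ∀ x, x ∈ Finset.univ.filter (fun x => orig x ∈ M) ↔ orig x ∈ M := by simp
  refine ⟨Finset.univ.filter fun x => orig x ∈ M, L.card_factor S hM hF, (hF e).2 heM,
    fun i => ?_, fun i v => ?_⟩
  · obtain ⟨f, hf⟩ := hMO i (by
      rw [Finset.card_image_of_injective _ fun _ _ h => by simpa using h]
      exact hodd i)
    obtain ⟨hfM, hfi⟩ := Finset.mem_inter.1 hf
    obtain ⟨x, hx, rfl⟩ := Finset.mem_image.1 hfi
    exact ⟨x, Finset.mem_inter.2 ⟨(hF x).2 hfM, hx⟩⟩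
  · by_cases h : (O i ∩ incG v).Nonempty
    · have := hM.card_pair hF h
      omega
    · rw [Finset.not_nonempty_iff_eq_empty.1 h]
      simp

end GadgetFactor

section Translation

variable {V : Type*} {G : SimpleGraph V}

theorem _root_.SimpleGraph.Preconnected.imp_of_adj {U : Type*} {H : SimpleGraph U}
    (h : H.Preconnected) {P : U → Prop} (hP : ∀ a b, H.Adj a b → P a → P b) (a b : U) (ha : P a) :
    P b := by
  obtain ⟨w⟩ := h a b
  induction w with
  | nil => exact ha
  | cons hadj _ ih => exact ih (hP _ _ hadj ha)

theorem card_eq_sdeg (H : G.Subgraph) (v : V) (S : Finset G.edgeSet)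
    (hS : ∀ x, x ∈ S ↔ x.1 ∈ H.edgeSet ∧ v ∈ x.1) : S.card = sdeg H v := by
  rw [sdeg, ← Set.ncard_coe_finset]
  symm
  refine Set.ncard_congr (fun w hw => ⟨s(v, w), H.edgeSet_subset (H.mem_edgeSet.2 hw)⟩) ?_ ?_ ?_
  · intro w hw
    exact (hS _).2 ⟨H.mem_edgeSet.2 hw, Sym2.mem_mk_left v w⟩
  · intro a b _ _ h
    exact Sym2.congr_right.1 (congrArg Subtype.val h)
  · rintro ⟨x, hx⟩ hxS
    obtain ⟨hxH, hv⟩ := (hS _).1 hxS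
    obtain ⟨w, rfl⟩ := Sym2.mem_iff_exists.1 hv
    exact ⟨w, H.mem_edgeSet.1 hxH, rfl⟩

theorem finite_subgraph [Finite V] : Finite G.Subgraph :=
  Finite.of_injective (fun H : G.Subgraph => (H.verts, H.Adj)) fun H K h => by
    rw [Prod.mk.injEq] at h
    exact SimpleGraph.Subgraph.ext h.1 h.2

open Classical in
theorem isCycleSystem [Fintype V] {t : ℕ} (hconn : TwoConnected G) (hreg : IsRegular G (3 * t))
    {𝒪 : Set G.Subgraph} (hcyc : ∀ O ∈ 𝒪, IsCycleSG O) (hdisj : PairwiseEdgeDisjoint 𝒪)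
    {O : 𝒪 → Finset G.edgeSet} (hO : ∀ i x, x ∈ O i ↔ x.1 ∈ i.1.edgeSet)
    {inc : V → Finset G.edgeSet} (hinc : ∀ v x, x ∈ inc v ↔ v ∈ x.1) : IsCycleSystem t inc O where
  ends := by
    rintro ⟨x, hx⟩
    induction x with
    | h p q => exact ⟨p, q, G.ne_of_adj hx, fun w => by simp [hinc]⟩
  card_inc v := by
    rw [card_eq_sdeg ⊤ v, ← hreg v]
    · rw [sdeg]
      rfl
    · intro x
      simp [hinc]
  disj i j hij := by
    rw [Finset.disjoint_left]
    intro x hi hj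
    exact Set.disjoint_left.1 (hdisj i.2 j.2 fun h => hij (Subtype.ext h)) ((hO i x).1 hi)
      ((hO j x).1 hj)
  two i v := by
    rintro ⟨x, hx⟩
    rw [Finset.mem_inter, hO, hinc] at hx
    rw [card_eq_sdeg i.1 v _ fun x => by rw [Finset.mem_inter, hO, hinc]]
    exact (hcyc i i.2).2 v (SimpleGraph.Subgraph.mem_verts_of_mem_edge hx.1 hx.2)
  conn_cycle i P hP p q := by
    rintro ⟨x, hx⟩ ⟨y, hy⟩
    rw [Finset.mem_inter, hO, hinc] at hx hy
    refine (hcyc i i.2).1.coe.preconnected.imp_of_adj (P := fun a => P a.1) ?_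
      ⟨p, SimpleGraph.Subgraph.mem_verts_of_mem_edge hx.1 hx.2⟩
      ⟨q, SimpleGraph.Subgraph.mem_verts_of_mem_edge hy.1 hy.2⟩
    intro a b hab
    exact hP ⟨s(a.1, b.1), i.1.edgeSet_subset hab⟩ ((hO _ _).2 hab) _ _ ((hinc _ _).2 (by simp))
      ((hinc _ _).2 (by simp))
  conn v P hP p q hp hq := by
    refine (hconn.2.2 v).preconnected.imp_of_adj (P := fun a => P a.1) ?_ ⟨p, hp⟩ ⟨q, hq⟩
    intro a b hab
    refine hP ⟨s(a.1, b.1), hab⟩ ?_ _ _ ((hinc _ _).2 (by simp)) ((hinc _ _).2 (by simp))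
    rw [hinc]
    have ha : a.1 ≠ v := a.2
    have hb : b.1 ≠ v := b.2
    simp [ha.symm, hb.symm]

/-- The spanning subgraph with a given set of edges. -/
def spanningOf (F : Finset G.edgeSet) : G.Subgraph where
  verts := Set.univ
  Adj a b := ∃ h : G.Adj a b, (⟨s(a, b), h⟩ : G.edgeSet) ∈ F
  adj_sub h := h.1
  edge_vert _ := Set.mem_univ _
  symm := ⟨by
    rintro a b ⟨h, hF⟩
    refine ⟨h.symm, ?_⟩
    convert! hF using 1
    exact Subtype.ext Sym2.eq_swap⟩

theorem mem_edgeSet_spanningOf {F : Finset G.edgeSet} {x : Sym2 V} :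
    x ∈ (spanningOf F).edgeSet ↔ ∃ h : x ∈ G.edgeSet, (⟨x, h⟩ : G.edgeSet) ∈ F := by
  induction x with
  | h p q => rfl

end Translation

/-- In a 2-connected 3t-regular graph, for any set of pairwise edge-disjoint odd cycles
and any edge `e`, there is a `t`-factor `F` containing `e` whose intersection with each
cycle of the set is a non-empty matching. -/
theorem stmt_1 {V : Type*} [Fintype V] (t : ℕ) (ht : 1 ≤ t) (G : SimpleGraph V)
    (hconn : TwoConnected G) (hreg : IsRegular G (3 * t))
    (𝒪 : Set G.Subgraph) (hodd : ∀ O ∈ 𝒪, IsOddCycleSG O)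
    (hdisj : PairwiseEdgeDisjoint 𝒪)
    (e : Sym2 V) (he : e ∈ G.edgeSet) :
    ∃ F : G.Subgraph, IsTFactor F t ∧ e ∈ F.edgeSet ∧
      ∀ O ∈ 𝒪, (F.edgeSet ∩ O.edgeSet).Nonempty ∧
        IsMatchingSet (F.edgeSet ∩ O.edgeSet) := by
  classical
  have := finite_subgraph (G := G)
  have := Fintype.ofFinite 𝒪
  have := Fintype.ofFinite G.edgeSet
  let O : 𝒪 → Finset G.edgeSet := fun i => Finset.univ.filter fun x => x.1 ∈ i.1.edgeSet
  let inc : V → Finset G.edgeSet := fun v => Finset.univ.filter fun x => v ∈ x.1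
  have hO : ∀ i x, x ∈ O i ↔ x.1 ∈ i.1.edgeSet := by simp [O]
  have hinc : ∀ v x, x ∈ inc v ↔ v ∈ x.1 := by simp [inc]
  have S : IsCycleSystem t inc O :=
    isCycleSystem hconn hreg (fun C hC => (hodd C hC).1) hdisj hO hinc
  have hcard : ∀ i, Odd (O i).card := by
    intro i
    have h1 : (Subtype.val '' (O i : Set G.edgeSet)) = i.1.edgeSet := by
      ext x
      simp only [Set.mem_image, Finset.mem_coe, hO, Subtype.exists, exists_and_right,
        exists_eq_right]
      exact ⟨fun h => h.2, fun h => ⟨i.1.edgeSet_subset h, h⟩⟩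
    rw [← Set.ncard_coe_finset, ← Set.ncard_image_of_injective _ Subtype.val_injective, h1]
    exact (hodd i i.2).2
  obtain ⟨F, hFt, heF, hFne, hF1⟩ := S.exists_factor ht hcard ⟨e, he⟩
  refine ⟨spanningOf F, ⟨fun _ => Set.mem_univ _, fun v => ?_⟩,
    mem_edgeSet_spanningOf.2 ⟨he, heF⟩, fun C hC => ⟨?_, ?_⟩⟩
  · rw [← card_eq_sdeg (spanningOf F) v (F ∩ inc v), hFt]
    intro x
    rw [Finset.mem_inter, hinc, mem_edgeSet_spanningOf]
    exact and_congr_left fun _ => ⟨fun h => ⟨x.2, h⟩, fun h => h.2⟩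
  · obtain ⟨x, hx⟩ := hFne ⟨C, hC⟩
    rw [Finset.mem_inter, hO] at hx
    exact ⟨x.1, mem_edgeSet_spanningOf.2 ⟨x.2, hx.1⟩, hx.2⟩
  · rintro x ⟨hxF, hxC⟩ y ⟨hyF, hyC⟩ hxy v hvx hvy
    obtain ⟨hx, hxF⟩ := mem_edgeSet_spanningOf.1 hxF
    obtain ⟨hy, hyF⟩ := mem_edgeSet_spanningOf.1 hyF
    have h1 := Finset.card_le_one.1 (hF1 ⟨C, hC⟩ v) ⟨x, hx⟩
      (by simp only [Finset.mem_inter, hO, hinc]; exact ⟨hxF, hxC, hvx⟩) ⟨y, hy⟩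
      (by simp only [Finset.mem_inter, hO, hinc]; exact ⟨hyF, hyC, hvy⟩)
    exact hxy (congrArg Subtype.val h1)

end PaperFormalization
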